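/- arXiv:1010.0590 — 2 statements merged into one kernel-verified Lean document; each statement's English description precedes it below -/
import Mathlib

section
/- Let X be a complete locally compact metric tree without leaves and with no valency-2 vertices. A dynamical transport plan μ (a Borel probability measure on the set of unit-speed complete geodesics of X) is d²-cyclically monotone — meaning that for all times s, t the coupling (e_s,e_t)_#μ has d²-cyclically monotone support — if and only if μ⊗μ-almost no pair of geodesics in its support is antagonist, i.e. no edge of X is traversed by two geodesics of the support in opposite directions. -/
open MeasureTheory Filter Set Topology
open scoped NNReal ENNReal

noncomputable section


/-! ## Geodesics and Hadamard spaces -/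

/-- `γ` is a geodesic on the set of parameters `s`, of speed `v`, with respect to the
distance function `d`. -/
def IsGeodesicOnWith {A : Type*} (d : A → A → ℝ) (γ : ℝ → A) (s : Set ℝ) (v : ℝ) : Prop :=
  ∀ t ∈ s, ∀ t' ∈ s, d (γ t) (γ t') = v * |t - t'|

/-- A metric space is geodesic if any two points are joined by a geodesic. -/
def IsGeodesicSpace (Y : Type*) [MetricSpace Y] : Prop :=
  ∀ x y : Y, ∃ γ : ℝ → Y, γ 0 = x ∧ γ 1 = y ∧
    IsGeodesicOnWith dist γ (Set.Icc (0:ℝ) 1) (dist x y)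

/-- Every geodesic segment extends to a complete geodesic (defined on all of `ℝ`). -/
def GeodesicallyComplete (Y : Type*) [MetricSpace Y] : Prop :=
  ∀ (γ : ℝ → Y) (a b v : ℝ), a < b → IsGeodesicOnWith dist γ (Set.Icc a b) v →
    ∃ g : ℝ → Y, IsGeodesicOnWith dist g Set.univ v ∧ ∀ t ∈ Set.Icc a b, g t = γ t

/-- A Hadamard space: complete, separable, locally compact, geodesic, globally CAT(0).
The CAT(0) comparison inequality is expressed through the explicit formula for the distance
from a vertex to a point of the opposite side in the Euclidean comparison triangle. -/
structure IsHadamard (X : Type*) [MetricSpace X] : Prop where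
  complete : CompleteSpace X
  separable : TopologicalSpace.SeparableSpace X
  locallyCompact : LocallyCompactSpace X
  geodesic : IsGeodesicSpace X
  cat0 : ∀ (x y z : X) (γ : ℝ → X), γ 0 = y → γ 1 = z →
    IsGeodesicOnWith dist γ (Set.Icc (0:ℝ) 1) (dist y z) →
    ∀ t ∈ Set.Icc (0:ℝ) 1,
      dist x (γ t) ^ 2 ≤ (1 - t) * dist x y ^ 2 + t * dist x z ^ 2 - t * (1 - t) * dist y z ^ 2

/-- A space is non-branching if two geodesics coinciding on a nonempty open set of parameters
coincide on their whole common interval of definition. -/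
def NonBranching (X : Type*) [MetricSpace X] : Prop :=
  ∀ (γ β : ℝ → X) (I : Set ℝ) (v w : ℝ),
    IsGeodesicOnWith dist γ I v → IsGeodesicOnWith dist β I w →
    (∃ U : Set ℝ, U ⊆ I ∧ IsOpen U ∧ U.Nonempty ∧ ∀ t ∈ U, γ t = β t) →
    ∀ t ∈ I, γ t = β t

/-! ## The Wasserstein space -/

/-- `π` is a coupling (transport plan) between `μ` and `ν`. -/
def IsCoupling {A B : Type*} [MeasurableSpace A] [MeasurableSpace B]
    (π : Measure (A × B)) (μ : Measure A) (ν : Measure B) : Prop :=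
  π.map Prod.fst = μ ∧ π.map Prod.snd = ν

/-- The quadratic Wasserstein space over `Y`: Borel probability measures with finite second
moment. -/
abbrev W2Space (Y : Type*) [MetricSpace Y] [MeasurableSpace Y] : Type _ :=
  {μ : Measure Y // IsProbabilityMeasure μ ∧
    ∃ x₀ : Y, (∫⁻ x, ENNReal.ofReal (dist x₀ x) ^ 2 ∂μ) < ⊤}

/-- The quadratic transport cost between two measures. -/
def W2cost {Y : Type*} [MetricSpace Y] [MeasurableSpace Y] (μ ν : Measure Y) : ℝ≥0∞ :=
  ⨅ (π : Measure (Y × Y)) (_ : IsCoupling π μ ν),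
    ∫⁻ p, ENNReal.ofReal (dist p.1 p.2) ^ 2 ∂π

/-- The quadratic Wasserstein distance. -/
def Wdist {Y : Type*} [MetricSpace Y] [MeasurableSpace Y] (μ ν : W2Space Y) : ℝ :=
  Real.sqrt (W2cost μ.1 ν.1).toReal


/-! ## Rays, complete geodesics, the boundary at infinity and the cone over it -/

/-- Geodesic rays of `X` (arbitrary nonnegative speed), parametrized by `ℝ≥0`.
The topology (of a subtype of a product) coincides on this set with the topology of
uniform convergence on compact sets. -/
abbrev RaySpace (X : Type*) [MetricSpace X] : Type _ :=
  {γ : ℝ≥0 → X // ∃ v : ℝ, 0 ≤ v ∧ ∀ s t : ℝ≥0, dist (γ s) (γ t) = v * dist s t}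

/-- Unit speed geodesic rays of `X`. -/
abbrev UnitRay (X : Type*) [MetricSpace X] : Type _ :=
  {γ : ℝ≥0 → X // ∀ s t : ℝ≥0, dist (γ s) (γ t) = dist s t}

/-- Complete geodesics of `X` (arbitrary nonnegative speed). -/
abbrev GeoLine (X : Type*) [MetricSpace X] : Type _ :=
  {γ : ℝ → X // ∃ v : ℝ, 0 ≤ v ∧ ∀ s t : ℝ, dist (γ s) (γ t) = v * |s - t|}

/-- Complete unit speed geodesics of `X`. -/
abbrev UnitLine (X : Type*) [MetricSpace X] : Type _ :=
  {γ : ℝ → X // ∀ s t : ℝ, dist (γ s) (γ t) = |s - t|}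

/-- Evaluation of a ray at time `t`. -/
def rayEval {X : Type*} [MetricSpace X] (t : ℝ≥0) : RaySpace X → X := fun γ => γ.1 t

/-- Two curves (w.r.t. a distance function `d`) are asymptotic if they stay at bounded
distance. -/
def AsymptoticMaps {A : Type*} (d : A → A → ℝ) (γ β : ℝ≥0 → A) : Prop :=
  ∃ C : ℝ, ∀ t, d (γ t) (β t) ≤ C

/-- The asymptote relation on unit-speed rays. -/
def unitRaySetoid (X : Type*) [MetricSpace X] : Setoid (UnitRay X) where
  r γ β := AsymptoticMaps dist γ.1 β.1
  iseqv := by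
    refine ⟨fun γ => ⟨0, fun t => by simp⟩, ?_, ?_⟩
    · rintro γ β ⟨C, h⟩
      exact ⟨C, fun t => by rw [dist_comm]; exact h t⟩
    · rintro γ β δ ⟨C, h⟩ ⟨C', h'⟩
      exact ⟨C + C', fun t => (dist_triangle _ _ _).trans (add_le_add (h t) (h' t))⟩

/-- The geodesic boundary of `X`: asymptote classes of unit-speed rays, with the quotient
topology of the topology of uniform convergence on compact sets (the cone topology). -/
abbrev Boundary (X : Type*) [MetricSpace X] := Quotient (unitRaySetoid X)

/-- Apex-like points, to be collapsed when forming the cone over `B`. -/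
def coneIsApex {B : Type*} : B × ℝ≥0 ⊕ Unit → Prop
  | Sum.inl p => p.2 = 0
  | Sum.inr _ => True

/-- The relation collapsing all apex-like points. -/
def coneSetoid (B : Type*) : Setoid (B × ℝ≥0 ⊕ Unit) where
  r p q := p = q ∨ (coneIsApex p ∧ coneIsApex q)
  iseqv := by
    refine ⟨fun p => Or.inl rfl, ?_, ?_⟩
    · rintro p q (rfl | h)
      · exact Or.inl rfl
      · exact Or.inr ⟨h.2, h.1⟩
    · rintro p q r (rfl | h) (rfl | h')
      · exact Or.inl rfl
      · exact Or.inr h'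
      · exact Or.inr h
      · exact Or.inr ⟨h.1, h'.2⟩

/-- The cone over a space `B`: the quotient of `B × [0,∞)` collapsing the zero level to the
apex, with the quotient topology. -/
abbrev Cone (B : Type*) := Quotient (coneSetoid B)

/-- The point of the cone over `b` at height (speed) `s`. -/
def coneMk {B : Type*} (b : B) (s : ℝ≥0) : Cone B :=
  Quotient.mk (coneSetoid B) (Sum.inl (b, s))

/-- The apex of the cone. -/
def conePt (B : Type*) : Cone B := Quotient.mk (coneSetoid B) (Sum.inr ())

private def coneSpeedAux {B : Type*} : B × ℝ≥0 ⊕ Unit → ℝ≥0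
  | Sum.inl p => p.2
  | Sum.inr _ => 0

/-- The speed (radial) coordinate of a point of the cone. -/
def coneSpeed {B : Type*} : Cone B → ℝ≥0 :=
  Quotient.lift coneSpeedAux (by
    rintro p q (rfl | ⟨h1, h2⟩)
    · rfl
    · cases p <;> cases q <;> simp_all [coneIsApex, coneSpeedAux])

/-- The speed of a geodesic ray. -/
def raySpeed {X : Type*} [MetricSpace X] (γ : RaySpace X) : ℝ≥0 :=
  nndist (γ.1 0) (γ.1 1)

lemma raySpeed_eq {X : Type*} [MetricSpace X] (γ : RaySpace X) {v : ℝ} (hv0 : 0 ≤ v)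
    (hv : ∀ s t : ℝ≥0, dist (γ.1 s) (γ.1 t) = v * dist s t) : (raySpeed γ : ℝ) = v := by
  have h1 := hv 0 1
  have h2 : dist (0 : ℝ≥0) (1 : ℝ≥0) = 1 := by rw [NNReal.dist_eq]; norm_num
  rw [h2, mul_one] at h1
  rw [show (raySpeed γ : ℝ) = dist (γ.1 0) (γ.1 1) from (dist_nndist _ _).symm, h1]

/-- The unit reparametrization of a nonconstant ray. -/
def rayUnit {X : Type*} [MetricSpace X] (γ : RaySpace X) (h : raySpeed γ ≠ 0) : UnitRay X := by
  refine ⟨fun t => γ.1 (t / raySpeed γ), ?_⟩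
  obtain ⟨v, hv0, hv⟩ := γ.2
  have hveq : (raySpeed γ : ℝ) = v := raySpeed_eq γ hv0 hv
  intro s t
  have hr : (raySpeed γ : ℝ) ≠ 0 := by
    simpa using h
  show dist (γ.1 (s / raySpeed γ)) (γ.1 (t / raySpeed γ)) = dist s t
  rw [hv, NNReal.dist_eq, NNReal.dist_eq, NNReal.coe_div, NNReal.coe_div,
    div_sub_div_same, abs_div, abs_of_nonneg (raySpeed γ).coe_nonneg, ← hveq]
  field_simp

/-- The point at infinity (in the cone over the boundary) defined by a geodesic ray:
its asymptote class together with its speed; constant rays are sent to the apex. -/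
def rayEnd {X : Type*} [MetricSpace X] (γ : RaySpace X) : Cone (Boundary X) :=
  if h : raySpeed γ = 0 then conePt (Boundary X)
  else coneMk (Quotient.mk (unitRaySetoid X) (rayUnit γ h)) (raySpeed γ)

/-! ## Asymptotic distance -/

def dInfty {X : Type*} [MetricSpace X] (γ β : ℝ≥0 → X) : ℝ :=
  Filter.limsup (fun t : ℝ≥0 => dist (γ t) (β t) / (t : ℝ)) Filter.atTop

/-- The asymptotic (angular) distance on the boundary, computed on representative rays
(it does not depend on the choice of representatives). -/
def boundaryDist {X : Type*} [MetricSpace X] (ξ ζ : Boundary X) : ℝ :=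
  dInfty (ξ.out).1 (ζ.out).1

def coneDistAux {X : Type*} [MetricSpace X] :
    Boundary X × ℝ≥0 ⊕ Unit → Boundary X × ℝ≥0 ⊕ Unit → ℝ
  | Sum.inl p, Sum.inl q =>
      Real.sqrt (((p.2 : ℝ) - (q.2 : ℝ)) ^ 2 + (p.2 : ℝ) * (q.2 : ℝ) * boundaryDist p.1 q.1 ^ 2)
  | Sum.inl p, Sum.inr _ => p.2
  | Sum.inr _, Sum.inl q => q.2
  | Sum.inr _, Sum.inr _ => 0

/-- The asymptotic distance on the cone over the boundary (the cone metric). -/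
def coneDist {X : Type*} [MetricSpace X] : Cone (Boundary X) → Cone (Boundary X) → ℝ :=
  Quotient.lift₂ coneDistAux (by
    rintro a₁ a₂ b₁ b₂ h12 h34
    rcases h12 with rfl | ⟨h1, h2⟩ <;> rcases h34 with rfl | ⟨h3, h4⟩
    · rfl
    · rcases a₁ with p | u <;> rcases a₂ with q | v <;> rcases b₂ with q' | w <;>
        simp_all [coneIsApex, coneDistAux, Real.sqrt_sq, NNReal.coe_nonneg]
    · rcases a₂ with q | u <;> rcases a₁ with p | v <;> rcases b₁ with p' | w <;>
        simp_all [coneIsApex, coneDistAux, Real.sqrt_sq, NNReal.coe_nonneg]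
    · rcases a₁ with p | u <;> rcases a₂ with q | v <;> rcases b₁ with p' | w <;>
        rcases b₂ with q' | w' <;>
        simp_all [coneIsApex, coneDistAux, Real.sqrt_sq, NNReal.coe_nonneg])


-- Borel measurable structure on the boundary and the cone over it.
instance (X : Type*) [MetricSpace X] : MeasurableSpace (Boundary X) := borel _
instance (X : Type*) [MetricSpace X] : BorelSpace (Boundary X) := ⟨rfl⟩
instance (X : Type*) [MetricSpace X] : MeasurableSpace (Cone (Boundary X)) := borel _
instance (X : Type*) [MetricSpace X] : BorelSpace (Cone (Boundary X)) := ⟨rfl⟩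

/-- The Wasserstein metric `W_∞` on measures on the cone over the boundary, built from the
cost `d_∞²`. -/
def Winfty {X : Type*} [MetricSpace X] (m m' : Measure (Cone (Boundary X))) : ℝ :=
  Real.sqrt (⨅ (π : Measure (Cone (Boundary X) × Cone (Boundary X)))
    (_ : IsCoupling π m m'),
      ∫⁻ p, ENNReal.ofReal (coneDist p.1 p.2) ^ 2 ∂π).toReal


/-! ## Visibility -/

/-- `X` is a visibility space: any two distinct boundary points are the two endpoints of a
complete geodesic. -/
def IsVisibility (X : Type*) [MetricSpace X] : Prop :=
  ∀ α ω : UnitRay X, ¬ AsymptoticMaps dist α.1 ω.1 →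
    ∃ g : ℝ → X, (∀ s t : ℝ, dist (g s) (g t) = |s - t|) ∧
      AsymptoticMaps dist (fun t : ℝ≥0 => g (-(t : ℝ))) α.1 ∧
      AsymptoticMaps dist (fun t : ℝ≥0 => g (t : ℝ)) ω.1

/-! ## Curves, length, rectifiability -/

/-- The length of a curve with respect to a distance function `d`, as a supremum over
finite monotone sequences of parameters in `[a,b]`. -/
def curveLengthWith {A : Type*} (d : A → A → ℝ) (c : ℝ → A) (a b : ℝ) : ℝ≥0∞ :=
  ⨆ (n : ℕ) (t : Fin (n + 1) → ℝ) (_ : Monotone t) (_ : ∀ i, t i ∈ Set.Icc a b),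
    ∑ i : Fin n, ENNReal.ofReal (d (c (t i.castSucc)) (c (t i.succ)))

/-- Continuity of a curve with respect to a distance function `d`, on a set of parameters. -/
def ContinuousWithRespect {A : Type*} (d : A → A → ℝ) (c : ℝ → A) (s : Set ℝ) : Prop :=
  ∀ t ∈ s, ∀ ε : ℝ, 0 < ε → ∃ δ : ℝ, 0 < δ ∧ ∀ u ∈ s, |u - t| < δ → d (c u) (c t) < ε

/-- `W_∞` between measures on the boundary, viewed as the level `{speed = 1}` of the cone,
with cost `d_∞²`. -/
def WinftyLevel1 {X : Type*} [MetricSpace X] (m m' : Measure (Boundary X)) : ℝ :=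
  Real.sqrt (⨅ (π : Measure (Boundary X × Boundary X)) (_ : IsCoupling π m m'),
    ∫⁻ p, ENNReal.ofReal (coneDist (coneMk p.1 1) (coneMk p.2 1)) ^ 2 ∂π).toReal

/-! ## Support of a measure -/

/-- The (topological) support of a measure. -/
def msupport {A : Type*} [TopologicalSpace A] [MeasurableSpace A] (μ : Measure A) : Set A :=
  {x | ∀ U : Set A, x ∈ U → IsOpen U → 0 < μ U}

/-! ## Cyclical monotonicity and antagonism -/

/-- A set `Γ` is `c`-cyclically monotone if no cyclic permutation of the target points of a
finite family of pairs of `Γ` decreases the total cost. -/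
def CyclicallyMonotone {A : Type*} (c : A → A → ℝ) (Γ : Set (A × A)) : Prop :=
  ∀ (m : ℕ) (p : Fin (m + 1) → A × A), (∀ i, p i ∈ Γ) →
    (∑ i, c (p i).1 (p i).2) ≤ ∑ i, c (p i).1 (p (i + 1)).2

/-- Two curves are antagonist if they pass through two distinct points in opposite orders. -/
def Antagonist {X : Type*} (γ β : ℝ → X) : Prop :=
  ∃ x y : X, x ≠ y ∧ (∃ s t : ℝ, s < t ∧ γ s = x ∧ γ t = y) ∧
    (∃ s t : ℝ, s < t ∧ β s = y ∧ β t = x)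

/-! ## Negative curvature, trees -/

/-- Three points lying on a common geodesic. -/
def Aligned {X : Type*} [MetricSpace X] (x y z : X) : Prop :=
  dist x y + dist y z = dist x z ∨ dist y x + dist x z = dist y z ∨
    dist x z + dist z y = dist x y

/-- `X` is negatively curved: it is not a line, and the CAT(0) comparison inequality is
strict except for aligned triangles. -/
def IsNegativelyCurved (X : Type*) [MetricSpace X] : Prop :=
  (¬ ∃ f : ℝ → X, Function.Surjective f ∧ ∀ s t : ℝ, dist (f s) (f t) = |s - t|) ∧
  ∀ (x y z : X) (γ : ℝ → X), γ 0 = y → γ 1 = z →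
    IsGeodesicOnWith dist γ (Set.Icc (0:ℝ) 1) (dist y z) → ¬ Aligned x y z →
    ∀ t ∈ Set.Ioo (0:ℝ) 1,
      dist x (γ t) ^ 2 < (1 - t) * dist x y ^ 2 + t * dist x z ^ 2 - t * (1 - t) * dist y z ^ 2

/-- A metric tree (real tree): a geodesic space satisfying the four-point 0-hyperbolicity
condition. -/
def IsRealTree (X : Type*) [MetricSpace X] : Prop :=
  IsGeodesicSpace X ∧ ∀ x y z w : X,
    dist x y + dist z w ≤ max (dist x z + dist y w) (dist x w + dist y z)

/-! ## Ends of complete geodesics -/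

/-- The forward ray of a complete geodesic. -/
def lineForward {X : Type*} [MetricSpace X] (γ : GeoLine X) : RaySpace X :=
  ⟨fun t : ℝ≥0 => γ.1 (t : ℝ), by
    obtain ⟨v, hv0, hv⟩ := γ.2
    exact ⟨v, hv0, fun s t => by rw [hv, NNReal.dist_eq]⟩⟩

/-- The backward ray of a complete geodesic. -/
def lineBackward {X : Type*} [MetricSpace X] (γ : GeoLine X) : RaySpace X :=
  ⟨fun t : ℝ≥0 => γ.1 (-(t : ℝ)), by
    obtain ⟨v, hv0, hv⟩ := γ.2
    refine ⟨v, hv0, fun s t => ?_⟩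
    rw [hv, NNReal.dist_eq]
    congr 1
    rw [abs_sub_comm]
    congr 1
    ring⟩

/-- The end at `+∞` of a complete geodesic, in the cone over the boundary. -/
def lineEndPlus {X : Type*} [MetricSpace X] (γ : GeoLine X) : Cone (Boundary X) :=
  rayEnd (lineForward γ)

/-- The end at `-∞` of a complete geodesic, in the cone over the boundary. -/
def lineEndMinus {X : Type*} [MetricSpace X] (γ : GeoLine X) : Cone (Boundary X) :=
  rayEnd (lineBackward γ)

/-- `g` is a unit complete geodesic with ends `ξ` (at `-∞`) and `ζ` (at `+∞`). -/
def LineConnects {X : Type*} [MetricSpace X] (g : ℝ → X) (ξ ζ : Boundary X) : Prop :=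
  (∀ s t : ℝ, dist (g s) (g t) = |s - t|) ∧
  (∃ γ : UnitRay X, Quotient.mk (unitRaySetoid X) γ = ξ ∧
    AsymptoticMaps dist (fun u : ℝ≥0 => g (-(u : ℝ))) γ.1) ∧
  (∃ γ : UnitRay X, Quotient.mk (unitRaySetoid X) γ = ζ ∧
    AsymptoticMaps dist (fun u : ℝ≥0 => g (u : ℝ)) γ.1)

/-- Two boundary points are antipodal if they are joined by a complete geodesic. -/
def Antipodal {X : Type*} [MetricSpace X] (ξ ζ : Boundary X) : Prop :=
  ∃ g : ℝ → X, LineConnects g ξ ζ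

/-- Two measures on the boundary are antipodal if they are concentrated on antipodal sets. -/
def AntipodalMeasures {X : Type*} [MetricSpace X] (νm νp : Measure (Boundary X)) : Prop :=
  ∃ A B : Set (Boundary X), MeasurableSet A ∧ MeasurableSet B ∧ νm A = 1 ∧ νp B = 1 ∧
    ∀ ξ ∈ A, ∀ ζ ∈ B, Antipodal ξ ζ

/-- Two measures on the boundary are uniformly antipodal if their supports are antipodal. -/
def UniformlyAntipodal {X : Type*} [MetricSpace X] (νm νp : Measure (Boundary X)) : Prop :=
  ∀ ξ ∈ msupport νm, ∀ ζ ∈ msupport νp, Antipodal ξ ζ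

/-- The distance from the base point `x₀` to the geodesic line joining two boundary points
(for trees, the Gromov product). -/
def D0 {X : Type*} [MetricSpace X] (x₀ : X) (ξ ζ : Boundary X) : ℝ :=
  sInf {r : ℝ | ∃ g : ℝ → X, LineConnects g ξ ζ ∧ ∃ t : ℝ, r = dist x₀ (g t)}

/-- The unit geodesic from `ξ` to `ζ`, parametrized so that its time-`0` point is closest to
the base point `x₀`. -/
def lineFrom {X : Type*} [MetricSpace X] (x₀ : X) (ξ ζ : Boundary X) : ℝ → X :=
  haveI : Nonempty X := ⟨x₀⟩
  Classical.epsilon fun g : ℝ → X =>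
    LineConnects g ξ ζ ∧ dist x₀ (g 0) = D0 x₀ ξ ζ

/-! ## Flows on trees -/

/-- The set of boundary points whose rays eventually lie in `C`. -/
def compBdry {X : Type*} [MetricSpace X] (C : Set X) : Set (Boundary X) :=
  {ξ | ∀ γ : UnitRay X, Quotient.mk (unitRaySetoid X) γ = ξ →
    ∃ T : ℝ≥0, ∀ t : ℝ≥0, T ≤ t → γ.1 t ∈ C}

/-- The connected components of the complement of a point. -/
def treeComps {X : Type*} [TopologicalSpace X] (x : X) : Set (Set X) :=
  {C | ∃ y : X, y ≠ x ∧ C = connectedComponentIn {x}ᶜ y}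

/-- A vertex (branch point) of a tree: the complement has at least three components. -/
def IsTreeVertex {X : Type*} [TopologicalSpace X] (x : X) : Prop :=
  ∃ C₁ C₂ C₃ : Set X, C₁ ∈ treeComps x ∧ C₂ ∈ treeComps x ∧ C₃ ∈ treeComps x ∧
    C₁ ≠ C₂ ∧ C₂ ≠ C₃ ∧ C₁ ≠ C₃

/-- The value of the signed measure `ν₊ - ν₋` on a set of boundary points. -/
def sflow {X : Type*} [MetricSpace X] (νm νp : Measure (Boundary X))
    (S : Set (Boundary X)) : ℝ :=
  (νp S).toReal - (νm S).toReal

/-- The boundary directions at `x` carrying positive flow. -/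
def posBdrySet {X : Type*} [MetricSpace X] (νm νp : Measure (Boundary X)) (x : X) :
    Set (Boundary X) :=
  ⋃ (C : Set X) (_ : C ∈ treeComps x) (_ : 0 < sflow νm νp (compBdry C)), compBdry C

/-- The boundary directions at `x` carrying negative flow. -/
def negBdrySet {X : Type*} [MetricSpace X] (νm νp : Measure (Boundary X)) (x : X) :
    Set (Boundary X) :=
  ⋃ (C : Set X) (_ : C ∈ treeComps x) (_ : sflow νm νp (compBdry C) < 0), compBdry C

/-- The flow through the point `x`. -/
def flowAt {X : Type*} [MetricSpace X] (νm νp : Measure (Boundary X)) (x : X) : ℝ :=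
  sflow νm νp (posBdrySet νm νp x)

open Classical in
/-- The specific flow through `x`: the flow through `x`, not counting the edge pointing
towards the base point `x₀` when the latter is positive (resp. negative). -/
def specificFlow {X : Type*} [MetricSpace X] (νm νp : Measure (Boundary X))
    (x₀ x : X) : ℝ :=
  if x = x₀ then flowAt νm νp x
  else if 0 < sflow νm νp (compBdry (connectedComponentIn {x}ᶜ x₀)) then
    sflow νm νp (posBdrySet νm νp x \ compBdry (connectedComponentIn {x}ᶜ x₀))
  else if sflow νm νp (compBdry (connectedComponentIn {x}ᶜ x₀)) < 0 then
    - sflow νm νp (negBdrySet νm νp x \ compBdry (connectedComponentIn {x}ᶜ x₀))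
  else flowAt νm νp x

/-- The pair `(ν₋, ν₊)` is realized as the pair of ends of a complete unit-speed geodesic of
the Wasserstein space, through a displacement interpolation `m`. -/
def RealizableEnds {X : Type*} [MetricSpace X] [MeasurableSpace X]
    (νm νp : Measure (Boundary X)) : Prop :=
  ∃ (μt : ℝ → W2Space X) (m : Measure (GeoLine X)), IsProbabilityMeasure m ∧
    (∀ s t : ℝ, Wdist (μt s) (μt t) = |s - t|) ∧
    (∀ t : ℝ, m.map (fun γ : GeoLine X => γ.1 t) = (μt t).1) ∧
    m.map lineEndMinus = νm.map (fun ξ : Boundary X => coneMk ξ 1) ∧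
    m.map lineEndPlus = νp.map (fun ξ : Boundary X => coneMk ξ 1)

/-- The cost `∫ D₀² dπ` of a transport plan (the optimal transport problem for the cost
`-D₀²` is finite iff the supremum of this quantity over all couplings is finite, and its
minimizers are the maximizers of this quantity). -/
def D0cost {X : Type*} [MetricSpace X] (x₀ : X)
    (π : Measure (Boundary X × Boundary X)) : ℝ≥0∞ :=
  ∫⁻ p, ENNReal.ofReal (D0 x₀ p.1 p.2) ^ 2 ∂π

/-- The supremum of `∫ D₀² dπ` over couplings of `(ν₋, ν₊)`. -/
def D0supCost {X : Type*} [MetricSpace X] (x₀ : X) (νm νp : Measure (Boundary X)) : ℝ≥0∞ :=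
  ⨆ (π : Measure (Boundary X × Boundary X)) (_ : IsCoupling π νm νp), D0cost x₀ π

/-! ## The geodesic boundary of the Wasserstein space -/

/-- The metric topology of the Wasserstein distance. -/
instance (Y : Type*) [MetricSpace Y] [MeasurableSpace Y] : TopologicalSpace (W2Space Y) :=
  TopologicalSpace.generateFrom
    {S | ∃ (μ : W2Space Y) (ε : ℝ), S = {ν : W2Space Y | Wdist μ ν < ε}}

/-- Unit-speed geodesic rays of the Wasserstein space. -/
abbrev W2UnitRay (X : Type*) [MetricSpace X] [MeasurableSpace X] : Type _ :=
  {f : ℝ≥0 → W2Space X // ∀ s t : ℝ≥0, Wdist (f s) (f t) = dist s t}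

/-- Probability measures on the cone over the boundary with `∫ v² dν = 1`, with the weak
topology. -/
abbrev P1Cone (X : Type*) [MetricSpace X] : Type _ :=
  {ν : ProbabilityMeasure (Cone (Boundary X)) //
    ∫⁻ c, (coneSpeed c : ℝ≥0∞) ^ 2 ∂(ν : Measure (Cone (Boundary X))) = 1}

/-- Probability measures (as plain measures) on the cone over the boundary with
`∫ v² dν = 1`. -/
abbrev P1ConeM (X : Type*) [MetricSpace X] : Type _ :=
  {ν : Measure (Cone (Boundary X)) // IsProbabilityMeasure ν ∧
    ∫⁻ c, (coneSpeed c : ℝ≥0∞) ^ 2 ∂ν = 1}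


/-! ## Locally Riemannian points -/

/-- The Riemannian length of a path `γ : [0,1] → ℝⁿ` for the metric tensor `g`. -/
def riemannianPathLength {n : ℕ}
    (g : EuclideanSpace ℝ (Fin n) → EuclideanSpace ℝ (Fin n) →L[ℝ] EuclideanSpace ℝ (Fin n))
    (γ : ℝ → EuclideanSpace ℝ (Fin n)) : ℝ :=
  ∫ t in (0:ℝ)..1, Real.sqrt (@inner ℝ _ _ (g (γ t) (deriv γ t)) (deriv γ t))

/-- The Riemannian distance in `U ⊆ ℝⁿ` for the metric tensor `g`: the infimum of
Riemannian lengths of `C¹` paths in `U` joining the two points. -/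
def riemannianDist {n : ℕ} (U : Set (EuclideanSpace ℝ (Fin n)))
    (g : EuclideanSpace ℝ (Fin n) → EuclideanSpace ℝ (Fin n) →L[ℝ] EuclideanSpace ℝ (Fin n))
    (p q : EuclideanSpace ℝ (Fin n)) : ℝ :=
  sInf {L : ℝ | ∃ γ : ℝ → EuclideanSpace ℝ (Fin n), ContDiffOn ℝ 1 γ (Set.Icc (0:ℝ) 1) ∧
    (∀ t ∈ Set.Icc (0:ℝ) 1, γ t ∈ U) ∧ γ 0 = p ∧ γ 1 = q ∧ L = riemannianPathLength g γ}

/-- `x` admits a neighborhood isometric to an open subset of a Riemannian manifold of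
dimension at least 2 (expressed in a chart: an open subset of `ℝⁿ`, `n ≥ 2`, equipped with
the distance induced by a smooth positive-definite symmetric metric tensor). -/
def IsLocallyRiemannian (X : Type*) [MetricSpace X] (x : X) : Prop :=
  ∃ n : ℕ, 2 ≤ n ∧
  ∃ (U : Set (EuclideanSpace ℝ (Fin n)))
    (g : EuclideanSpace ℝ (Fin n) → EuclideanSpace ℝ (Fin n) →L[ℝ] EuclideanSpace ℝ (Fin n))
    (V : Set X) (φ : X → EuclideanSpace ℝ (Fin n)),
    IsOpen U ∧ ContDiffOn ℝ (⊤ : ℕ∞) g U ∧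
    (∀ p ∈ U, ∀ v w : EuclideanSpace ℝ (Fin n),
      @inner ℝ _ _ (g p v) w = @inner ℝ _ _ v (g p w)) ∧
    (∀ p ∈ U, ∀ v : EuclideanSpace ℝ (Fin n), v ≠ 0 → 0 < @inner ℝ _ _ (g p v) v) ∧
    V ∈ nhds x ∧ Set.BijOn φ V U ∧
    ∀ a ∈ V, ∀ b ∈ V, dist a b = riemannianDist U g (φ a) (φ b)

/-! ## The combinatorial perpendicular Radon transform on a tree -/

/-- `y` and `z` lie in the same connected component of the graph `G` minus the vertex `x`. -/
def sameComp {V : Type*} (G : SimpleGraph V) (x y z : V) : Prop :=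
  ∃ (hy : y ≠ x) (hz : z ≠ x), (G.induce {w : V | w ≠ x}).Reachable ⟨y, hy⟩ ⟨z, hz⟩

/-- The perpendicular `⊥ˣ(ef)` of a flag: the union of `{x}` and of the components of
`G - x` containing none of the vertices of `p` (for a flag, `p = {e, f}` is a pair of
neighbors of `x`). -/
def perpSet {V : Type*} (G : SimpleGraph V) (x : V) (p : Finset V) : Set V :=
  {x} ∪ {y | ∀ e ∈ p, ¬ sameComp G x y e}

/-- The combinatorial perpendicular Radon transform of a summable function `h` on the
vertices, evaluated on a flag `(x, p)`. -/
def perpRadon {V : Type*} (G : SimpleGraph V) (h : V → ℝ) (x : V) (p : Finset V) : ℝ :=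
  ∑' y : perpSet G x p, h y


/-! ## Optimality of assignments in trees -/

/-- In a space satisfying the four-point condition, an assignment that is pairwise optimal for
the distance cost is optimal. -/
theorem sum_dist_le_sum_dist_perm {X ι : Type*} [MetricSpace X] [Fintype ι]
    (h4 : ∀ x y z w : X,
      dist x y + dist z w ≤ max (dist x z + dist y w) (dist x w + dist y z))
    (x y : ι → X)
    (hpair : ∀ i j, dist (x i) (y i) + dist (x j) (y j) ≤ dist (x i) (y j) + dist (x j) (y i))
    (τ : Equiv.Perm ι) :
    ∑ i, dist (x i) (y i) ≤ ∑ i, dist (x i) (y (τ i)) := by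
  classical
  let cost : Equiv.Perm ι → ℝ := fun σ => ∑ i, dist (x i) (y (σ i))
  obtain ⟨σ, hσ⟩ := Finite.exists_min
    (fun σ : Equiv.Perm ι => toLex (cost σ, σ.support.card))
  have hmin : ∀ ρ, cost σ ≤ cost ρ := fun ρ => by
    rcases Prod.Lex.toLex_le_toLex.1 (hσ ρ) with h | h
    · exact h.le
    · exact h.1.le
  have hstrict : ∀ ρ : Equiv.Perm ι, ρ.support.card < σ.support.card → cost σ < cost ρ :=
    fun ρ hρ => by
      rcases Prod.Lex.toLex_le_toLex.1 (hσ ρ) with h | h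
      · exact h
      · exact absurd h.2 (by simpa using hρ)
  suffices h1 : σ = 1 by
    subst h1
    simpa [cost] using hmin τ
  by_contra hne
  have hsupp : σ.support.Nonempty := by
    rw [Finset.nonempty_iff_ne_empty]
    simpa [Equiv.Perm.support_eq_empty_iff] using hne
  -- exchanging the targets of two consecutive indices creates a fixed point
  have hswap : ∀ j, σ j ≠ j →
      dist (x j) (y (σ j)) + dist (x (σ j)) (y (σ (σ j))) <
        dist (x j) (y (σ (σ j))) + dist (x (σ j)) (y (σ j)) := by
    intro j hj
    have hj' : σ (σ j) ≠ σ j := fun h => hj (σ.injective h)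
    have hsub : (σ * Equiv.swap j (σ j)).support ⊂ σ.support := by
      rw [Finset.ssubset_iff_of_subset]
      · exact ⟨σ j, by simpa using hj', by simp⟩
      · intro i hi
        rw [Equiv.Perm.mem_support] at hi ⊢
        intro hfix
        have h1 : i ≠ j := by rintro rfl; exact hj hfix
        have h2 : i ≠ σ j := by rintro rfl; exact hj' hfix
        exact hi (by simp [Equiv.swap_apply_of_ne_of_ne h1 h2, hfix])
    have hlt := hstrict _ (Finset.card_lt_card hsub)
    have hsplit : ∀ f : ι → ℝ,
        ∑ i, f i = (f j + f (σ j)) + ∑ i ∈ (Finset.univ.erase j).erase (σ j), f i := by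
      intro f
      rw [add_assoc, Finset.add_sum_erase _ _ (by simp [hj]),
        Finset.add_sum_erase _ _ (Finset.mem_univ j)]
    simp only [cost] at hlt
    rw [hsplit, hsplit (fun i => dist (x i) (y ((σ * Equiv.swap j (σ j)) i)))] at hlt
    have hrest : ∑ i ∈ (Finset.univ.erase j).erase (σ j),
          dist (x i) (y ((σ * Equiv.swap j (σ j)) i)) =
        ∑ i ∈ (Finset.univ.erase j).erase (σ j), dist (x i) (y (σ i)) := by
      refine Finset.sum_congr rfl fun i hi => ?_
      simp only [Finset.mem_erase, Finset.mem_univ, and_true] at hi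
      simp [Equiv.swap_apply_of_ne_of_ne hi.2 hi.1]
    rw [hrest] at hlt
    simpa using hlt
  obtain ⟨i₀, hi₀⟩ := hsupp
  -- Gromov products with respect to a base point
  let g : X → X → ℝ := fun a b => dist (x i₀) a + dist (x i₀) b - dist a b
  have hg : ∀ a b, g a b = dist (x i₀) a + dist (x i₀) b - dist a b := fun _ _ => rfl
  have gcomm : ∀ a b, g a b = g b a := fun a b => by
    rw [hg, hg, dist_comm a b]; ring
  have gult : ∀ a b c, min (g a b) (g b c) ≤ g a c := by
    intro a b c
    have h := h4 a c (x i₀) b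
    rw [hg, hg, hg]
    rw [dist_comm a (x i₀), dist_comm c b, dist_comm c (x i₀)] at h
    rcases le_max_iff.1 h with h | h
    · exact (min_le_right _ _).trans (by linarith)
    · exact (min_le_left _ _).trans (by linarith)
  obtain ⟨k, hk, hkmax⟩ := σ.support.exists_max_image (fun k => g (x k) (y (σ k)))
    ⟨i₀, hi₀⟩
  have hk' : σ k ≠ k := Equiv.Perm.mem_support.1 hk
  -- geometric core: a farthest pair is strictly separated from a pair it cannot exchange with
  have key : ∀ i, σ i ≠ i →
      dist (x k) (y (σ k)) + dist (x i) (y (σ i)) <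
        dist (x k) (y (σ i)) + dist (x i) (y (σ k)) →
      g (x k) (y (σ i)) < g (x k) (y (σ k)) ∧ g (y (σ k)) (x i) < g (x k) (y (σ k)) := by
    intro i hi hlt
    have hle : g (x i) (y (σ i)) ≤ g (x k) (y (σ k)) :=
      hkmax i (Equiv.Perm.mem_support.2 hi)
    have hlt' : g (x k) (y (σ i)) + g (y (σ k)) (x i) <
        g (x k) (y (σ k)) + g (x i) (y (σ i)) := by
      rw [gcomm (y (σ k)), hg, hg, hg, hg]; linarith
    have e1 := gult (x k) (y (σ i)) (x i)
    have e2 := gult (y (σ k)) (x k) (x i)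
    have e3 := gult (y (σ k)) (x i) (y (σ i))
    have e4 := gult (x k) (y (σ k)) (y (σ i))
    have c1 := gcomm (y (σ i)) (x i)
    have c2 := gcomm (y (σ k)) (x k)
    simp only [min_le_iff] at e1 e2 e3 e4
    grind
  have hA := key (σ k) (fun h => hk' (σ.injective h)) (hswap k hk')
  obtain ⟨j, hj⟩ := σ.surjective k
  have hjk : σ j ≠ j := fun h => hk' (by rw [h] at hj; rwa [hj] at h)
  have hB := key j hjk (by
    have h := hswap j hjk
    rw [hj] at h ⊢
    linarith)
  rw [hj] at hB
  have hp := hpair k (σ k)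
  have hp' : g (x k) (y (σ k)) + g (x (σ k)) (y k) ≤
      g (x k) (y k) + g (x (σ k)) (y (σ k)) := by
    rw [hg, hg, hg, hg]; linarith
  have e1 := gult (x (σ k)) (y (σ k)) (y k)
  have e2 := gult (y (σ k)) (x k) (y k)
  have c1 := gcomm (x (σ k)) (y (σ k))
  have c2 := gcomm (y (σ k)) (x k)
  have e3 := hA.2
  have e4 := hB.1
  simp only [min_le_iff] at e1 e2
  grind

/-- In a tree, if exchanging the endpoints of two unit-speed geodesics strictly decreases the
total distance, then the geodesics are antagonist. -/
theorem antagonist_of_dist_add_dist_lt {X : Type*} [MetricSpace X]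
    (h4 : ∀ x y z w : X,
      dist x y + dist z w ≤ max (dist x z + dist y w) (dist x w + dist y z))
    (γ β : UnitLine X) {s t : ℝ} (hst : s < t)
    (h : dist (γ.1 s) (β.1 t) + dist (β.1 s) (γ.1 t) <
      dist (γ.1 s) (γ.1 t) + dist (β.1 s) (β.1 t)) :
    Antagonist γ.1 β.1 := by
  -- the point of the first geodesic facing the start of the second one is
  -- the point of the second geodesic facing the end of the first one
  have meet : ∀ γ β : UnitLine X,
      dist (γ.1 s) (β.1 t) + dist (β.1 s) (γ.1 t) <
        dist (γ.1 s) (γ.1 t) + dist (β.1 s) (β.1 t) →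
      γ.1 (s + (t - s + dist (γ.1 s) (β.1 s) - dist (β.1 s) (γ.1 t)) / 2) =
        β.1 (s + (t - s + dist (β.1 s) (γ.1 t) - dist (γ.1 t) (β.1 t)) / 2) := by
    intro γ β h
    have l1 : dist (γ.1 s) (γ.1 t) = t - s := by
      rw [γ.2, abs_sub_comm, abs_of_pos (by linarith)]
    have l2 : dist (β.1 s) (β.1 t) = t - s := by
      rw [β.2, abs_sub_comm, abs_of_pos (by linarith)]
    have hq1 := h4 (γ.1 s) (γ.1 t) (β.1 s) (β.1 t)
    have hq2 := h4 (γ.1 s) (β.1 s) (γ.1 t) (β.1 t)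
    have hin : ∀ (δ : UnitLine X) (z : X) (u : ℝ), s ≤ u → u ≤ t →
        dist z (δ.1 u) ≤ max (dist z (δ.1 s) - (u - s)) (dist z (δ.1 t) - (t - u)) := by
      intro δ z u hu1 hu2
      have h := h4 z (δ.1 u) (δ.1 s) (δ.1 t)
      rw [δ.2 s t, δ.2 u t, δ.2 u s, abs_sub_comm s t, abs_sub_comm u t,
        abs_of_nonneg (by linarith : 0 ≤ t - s), abs_of_nonneg (by linarith : 0 ≤ t - u),
        abs_of_nonneg (by linarith : 0 ≤ u - s)] at h
      rcases le_max_iff.1 h with h | h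
      · exact le_max_of_le_left (by linarith)
      · exact le_max_of_le_right (by linarith)
    have t1 := dist_triangle (γ.1 s) (β.1 s) (γ.1 t)
    have t2 := dist_triangle (β.1 s) (γ.1 s) (γ.1 t)
    have t3 := dist_triangle (γ.1 s) (γ.1 t) (β.1 s)
    have t4 := dist_triangle (β.1 s) (γ.1 t) (β.1 t)
    have t5 := dist_triangle (β.1 s) (β.1 t) (γ.1 t)
    have t6 := dist_triangle (γ.1 t) (β.1 s) (β.1 t)
    have c1 := dist_comm (γ.1 s) (β.1 s)
    have c2 := dist_comm (γ.1 t) (β.1 s)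
    have c3 := dist_comm (γ.1 t) (β.1 t)
    set b := s + (t - s + dist (γ.1 s) (β.1 s) - dist (β.1 s) (γ.1 t)) / 2 with hb
    set a := s + (t - s + dist (β.1 s) (γ.1 t) - dist (γ.1 t) (β.1 t)) / 2 with ha
    have ea := hin β (γ.1 s) a (by linarith) (by linarith)
    have eb := hin β (γ.1 t) a (by linarith) (by linarith)
    have ec := hin γ (β.1 a) b (by linarith) (by linarith)
    rw [dist_comm (β.1 a) (γ.1 s), dist_comm (β.1 a) (γ.1 t)] at ec
    rw [eq_comm, ← dist_le_zero]
    rw [le_max_iff] at hq1 hq2 ea eb ec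
    grind
  have m1 := meet γ β h
  have m2 := meet β γ (by linarith)
  have l1 : dist (γ.1 s) (γ.1 t) = t - s := by
    rw [γ.2, abs_sub_comm, abs_of_pos (by linarith)]
  have hq := h4 (γ.1 s) (γ.1 t) (β.1 s) (β.1 t)
  rw [dist_comm (γ.1 t) (β.1 s), le_max_iff] at hq
  rw [dist_comm (β.1 s) (γ.1 s), dist_comm (β.1 t) (γ.1 t)] at m2
  have hlt : s + (t - s + dist (γ.1 s) (β.1 t) - dist (γ.1 t) (β.1 t)) / 2 <
      s + (t - s + dist (γ.1 s) (β.1 s) - dist (β.1 s) (γ.1 t)) / 2 := by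
    rcases hq with hq | hq <;> linarith
  refine ⟨_, _, ?_, ⟨_, _, hlt, rfl, rfl⟩, ⟨_, _, ?_, m1.symm, m2⟩⟩
  · intro heq
    have h0 := γ.2 (s + (t - s + dist (γ.1 s) (β.1 t) - dist (γ.1 t) (β.1 t)) / 2)
      (s + (t - s + dist (γ.1 s) (β.1 s) - dist (β.1 s) (γ.1 t)) / 2)
    rw [heq, dist_self, eq_comm, abs_eq_zero] at h0
    linarith
  · linarith

/-- Two non-antagonist unit-speed geodesics of a tree are pairwise optimal at all times. -/
theorem dist_add_dist_le_of_not_antagonist {X : Type*} [MetricSpace X]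
    (h4 : ∀ x y z w : X,
      dist x y + dist z w ≤ max (dist x z + dist y w) (dist x w + dist y z))
    (γ β : UnitLine X) (h : ¬ Antagonist γ.1 β.1) (s t : ℝ) :
    dist (γ.1 s) (γ.1 t) + dist (β.1 s) (β.1 t) ≤
      dist (γ.1 s) (β.1 t) + dist (β.1 s) (γ.1 t) := by
  rcases lt_trichotomy s t with hst | rfl | hst
  · exact not_lt.1 fun hlt => h (antagonist_of_dist_add_dist_lt h4 γ β hst hlt)
  · simp only [dist_self, add_zero]
    positivity
  · refine not_lt.1 fun hlt => h (antagonist_of_dist_add_dist_lt h4 γ β hst ?_)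
    rw [dist_comm (γ.1 t) (β.1 s), dist_comm (β.1 t) (γ.1 s), dist_comm (γ.1 t) (γ.1 s),
      dist_comm (β.1 t) (β.1 s)]
    linarith

/-- Pairwise non-antagonist unit-speed geodesics of a tree give `d²`-cyclically monotone
couplings. -/
theorem cyclicallyMonotone_image_eval {X : Type*} [MetricSpace X]
    (h4 : ∀ x y z w : X,
      dist x y + dist z w ≤ max (dist x z + dist y w) (dist x w + dist y z))
    (S : Set (UnitLine X)) (hS : ∀ γ ∈ S, ∀ β ∈ S, ¬ Antagonist γ.1 β.1) (s t : ℝ) :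
    CyclicallyMonotone (fun a b : X => dist a b ^ 2)
      ((fun γ : UnitLine X => (γ.1 s, γ.1 t)) '' S) := by
  intro m p hp
  choose γ hγS hγ using hp
  simp only [← hγ]
  have hle := sum_dist_le_sum_dist_perm h4 (fun i => (γ i).1 s) (fun i => (γ i).1 t)
    (fun i j => dist_add_dist_le_of_not_antagonist h4 _ _ (hS _ (hγS i) _ (hγS j)) s t)
    (Equiv.addRight (1 : Fin (m + 1)))
  simp only [Equiv.coe_addRight, (γ _).2 s t, Finset.sum_const, Finset.card_univ,
    Fintype.card_fin, nsmul_eq_mul] at hle ⊢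
  have hcs := sq_sum_le_card_mul_sum_sq (s := (Finset.univ : Finset (Fin (m + 1))))
    (f := fun i => dist ((γ i).1 s) ((γ (i + 1)).1 t))
  simp only [Finset.card_univ, Fintype.card_fin] at hcs
  have hm : (0 : ℝ) < ((m + 1 : ℕ) : ℝ) := by positivity
  have hsq := pow_le_pow_left₀ (by positivity) hle 2
  refine le_of_mul_le_mul_left (le_trans (le_of_eq ?_) (hsq.trans hcs)) hm
  ring

/-- Cyclical monotonicity for a continuous cost passes to the closure. -/
theorem CyclicallyMonotone.closure {A : Type*} [TopologicalSpace A] {c : A → A → ℝ}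
    (hc : Continuous fun p : A × A => c p.1 p.2) {Γ : Set (A × A)}
    (h : CyclicallyMonotone c Γ) : CyclicallyMonotone c (_root_.closure Γ) := by
  intro m p hp
  have hclosed : IsClosed {q : Fin (m + 1) → A × A |
      (∑ i, c (q i).1 (q i).2) ≤ ∑ i, c (q i).1 (q (i + 1)).2} := by
    refine isClosed_le (continuous_finsetSum _ fun i _ => ?_)
      (continuous_finsetSum _ fun i _ => ?_)
    · exact hc.comp (by fun_prop)
    · exact hc.comp (f := fun q : Fin (m + 1) → A × A => ((q i).1, (q (i + 1)).2))
        (by fun_prop)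
  have hmem : p ∈ _root_.closure (Set.univ.pi fun _ : Fin (m + 1) => Γ) := by
    rw [closure_pi_set]
    exact fun i _ => hp i
  refine closure_minimal (fun q hq => ?_) hclosed hmem
  exact h m q fun i => Set.mem_univ_pi.1 hq i

theorem CyclicallyMonotone.mono {A : Type*} {c : A → A → ℝ} {Γ Γ' : Set (A × A)}
    (h : CyclicallyMonotone c Γ') (hsub : Γ ⊆ Γ') : CyclicallyMonotone c Γ :=
  fun m p hp => h m p fun i => hsub (hp i)

/-! ## Supports and push-forwards -/

theorem measure_compl_msupport {A : Type*} [TopologicalSpace A] [SecondCountableTopology A]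
    [MeasurableSpace A] (μ : Measure A) : μ (msupport μ)ᶜ = 0 := by
  refine measure_null_of_locally_null _ fun x hx => ?_
  simp only [msupport, Set.mem_compl_iff, Set.mem_ofPred_eq, not_forall, not_lt,
    nonpos_iff_eq_zero] at hx
  obtain ⟨U, hxU, hU, h0⟩ := hx
  exact ⟨U, mem_nhdsWithin_of_mem_nhds (hU.mem_nhds hxU), h0⟩

theorem map_mem_msupport {A B : Type*} [TopologicalSpace A] [MeasurableSpace A]
    [TopologicalSpace B] [MeasurableSpace B] {μ : Measure A} {f : A → B}
    (hf : Continuous f) (hfm : AEMeasurable f μ) {a : A} (ha : a ∈ msupport μ) :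
    f a ∈ msupport (μ.map f) := fun U haU hU =>
  (ha (f ⁻¹' U) haU (hU.preimage hf)).trans_le (Measure.le_map_apply hfm U)

theorem msupport_map_subset {A B : Type*} [TopologicalSpace A] [SecondCountableTopology A]
    [MeasurableSpace A] [TopologicalSpace B] [MeasurableSpace B] [OpensMeasurableSpace B]
    {μ : Measure A} {f : A → B} (hfm : AEMeasurable f μ) :
    msupport (μ.map f) ⊆ closure (f '' msupport μ) := by
  intro b hb
  rw [mem_closure_iff]
  intro U hU hbU
  have hpos := hb U hbU hU
  rw [Measure.map_apply_of_aemeasurable hfm hU.measurableSet] at hpos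
  by_contra hemp
  refine hpos.ne' (measure_mono_null (fun a ha => ?_) (measure_compl_msupport μ))
  exact fun hsup => hemp ⟨f a, ha, a, hsup, rfl⟩

theorem UnitLine.continuous_eval {X : Type*} [MetricSpace X] (t : ℝ) :
    Continuous fun γ : UnitLine X => γ.1 t :=
  (continuous_apply t).comp continuous_subtype_val

instance UnitLine.secondCountableTopology {X : Type*} [MetricSpace X]
    [SecondCountableTopology X] : SecondCountableTopology (UnitLine X) := by
  let r : UnitLine X → ℚ → X := fun γ q => γ.1 q
  have hr : IsInducing r := by
    refine isInducing_iff_nhds.2 fun γ => le_antisymm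
      ((continuous_pi fun q : ℚ => UnitLine.continuous_eval (q : ℝ)).tendsto γ).le_comap ?_
    rw [nhds_subtype_eq_comap, ← tendsto_iff_comap, tendsto_pi_nhds]
    intro t
    rw [Metric.tendsto_nhds]
    intro ε hε
    obtain ⟨q, hq⟩ := Rat.denseRange_cast (𝕜 := ℝ) |>.exists_dist_lt t
      (by positivity : 0 < ε / 3)
    have hev : Tendsto (fun β : UnitLine X => β.1 (q : ℝ)) (comap r (𝓝 (r γ)))
        (𝓝 (γ.1 (q : ℝ))) := ((continuous_apply q).tendsto (r γ)).comp tendsto_comap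
    filter_upwards [Metric.tendsto_nhds.1 hev (ε / 3) (by positivity)] with β hβ
    have h1 := β.2 t q
    have h2 := γ.2 q t
    rw [Real.dist_eq] at hq
    rw [abs_sub_comm] at h2
    have := dist_triangle4 (β.1 t) (β.1 q) (γ.1 q) (γ.1 t)
    linarith
  exact hr.secondCountableTopology

/-- If exchanging the endpoints of two unit-speed geodesics never decreases the total squared
distance, then they are not antagonist. -/
theorem not_antagonist_of_sq_dist_le {X : Type*} [MetricSpace X] (γ β : UnitLine X)
    (h : ∀ u v : ℝ, dist (γ.1 u) (γ.1 v) ^ 2 + dist (β.1 u) (β.1 v) ^ 2 ≤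
      dist (γ.1 u) (β.1 v) ^ 2 + dist (β.1 u) (γ.1 v) ^ 2) :
    ¬ Antagonist γ.1 β.1 := by
  rintro ⟨x, y, -, ⟨s, t, hst, hsx, hty⟩, ⟨s', t', hst', hsy, htx⟩⟩
  have hle : ∀ (δ : UnitLine X) (a b : ℝ), a ≤ b → dist (δ.1 a) (δ.1 b) = b - a := by
    intro δ a b hab
    rw [δ.2, abs_sub_comm, abs_of_nonneg (by linarith)]
  have hlen : t - s = t' - s' := by
    rw [← hle γ s t hst.le, ← hle β s' t' hst'.le, hsx, hty, hsy, htx, dist_comm]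
  set ℓ := t - s with hℓ
  have hℓpos : 0 < ℓ := by linarith
  set a := s - t' with ha
  set K := (a ^ 2 + (a + 2 * ℓ) ^ 2) / ℓ with hK
  have hK0 : 0 ≤ K := by positivity
  have hKℓ : K * ℓ = a ^ 2 + (a + 2 * ℓ) ^ 2 := by rw [hK]; field_simp
  set u := min s s' with hu
  set v := max t t' + K with hv
  have hus : u ≤ s := min_le_left _ _
  have hus' : u ≤ s' := min_le_right _ _
  have htv : t ≤ v := (le_max_left t t').trans (by linarith)
  have htv' : t' ≤ v := (le_max_right t t').trans (by linarith)
  have hKv : K + ℓ ≤ v - u := by linarith [le_max_left t t']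
  have h1 : dist (γ.1 u) (β.1 v) ≤ (v - u) + a := by
    have := dist_triangle (γ.1 u) x (β.1 v)
    rw [← hsx, hle γ u s hus, hsx, ← htx, hle β t' v htv'] at this
    linarith
  have h2 : dist (β.1 u) (γ.1 v) ≤ (v - u) - a - 2 * ℓ := by
    have := dist_triangle (β.1 u) y (γ.1 v)
    rw [← hsy, hle β u s' hus', hsy, ← hty, hle γ t v htv] at this
    linarith
  have h3 := h u v
  rw [hle γ u v (by linarith), hle β u v (by linarith)] at h3
  have h4 := pow_le_pow_left₀ dist_nonneg h1 2
  have h5 := pow_le_pow_left₀ dist_nonneg h2 2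
  have h6 := mul_le_mul_of_nonneg_right hKv hℓpos.le
  nlinarith

/-- **Statement 12.** On a complete locally compact geodesically complete metric tree, a
dynamical transport plan (a probability measure on unit-speed complete geodesics) is
`d²`-cyclically monotone if and only if no two geodesics of its support are antagonist. -/
theorem cyclically_monotone_iff_no_antagonist
    (X : Type*) [MetricSpace X] [MeasurableSpace X] [BorelSpace X]
    [CompleteSpace X] [TopologicalSpace.SeparableSpace X] [LocallyCompactSpace X]
    (htree : IsRealTree X) (hgc : GeodesicallyComplete X)
    (μ : Measure (UnitLine X)) (hp : IsProbabilityMeasure μ) :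
    (∀ s t : ℝ, CyclicallyMonotone (fun a b : X => dist a b ^ 2)
        (msupport (μ.map (fun γ : UnitLine X => (γ.1 s, γ.1 t))))) ↔
      ∀ γ ∈ msupport μ, ∀ β ∈ msupport μ, ¬ Antagonist (γ : UnitLine X).1 (β : UnitLine X).1 := by
  have : SecondCountableTopology X := UniformSpace.secondCountable_of_separable X
  have hcont : ∀ s t : ℝ, Continuous fun γ : UnitLine X => (γ.1 s, γ.1 t) := fun s t =>
    (UnitLine.continuous_eval s).prodMk (UnitLine.continuous_eval t)
  have hmeas : ∀ s t : ℝ, Measurable fun γ : UnitLine X => (γ.1 s, γ.1 t) := fun s t =>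
    ((measurable_pi_apply s).comp measurable_subtype_coe).prodMk
      ((measurable_pi_apply t).comp measurable_subtype_coe)
  constructor
  · intro h γ hγ β hβ
    refine not_antagonist_of_sq_dist_le γ β fun u v => ?_
    have hmem := map_mem_msupport (hcont u v) (hmeas u v).aemeasurable hγ
    have hmem' := map_mem_msupport (hcont u v) (hmeas u v).aemeasurable hβ
    have := h u v 1 ![(γ.1 u, γ.1 v), (β.1 u, β.1 v)] (by
      intro i
      fin_cases i
      · exact hmem
      · exact hmem')
    simpa [Fin.sum_univ_two] using this
  · intro h s t
    exact ((cyclicallyMonotone_image_eval htree.2 _ h s t).closure (by fun_prop)).mono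
      (msupport_map_subset (hmeas s t).aemeasurable)

end
end

section
/- Let X be a Hadamard space and x ∈ X. The set of unit-speed geodesic rays of W₂(X) starting at the Dirac mass δ_x is in one-to-one correspondence with the set P₁(c∂X) of probability measures ν on the cone c∂X satisfying ∫ v² ν(dv) = 1. Moreover, for every boundary point ξ ∈ ∂W₂(X) there exists a unique unit-speed geodesic ray of W₂(X) starting at δ_x and belonging to the asymptote class ξ. -/
open MeasureTheory Filter Set Topology
open scoped NNReal ENNReal

noncomputable section

/-! ## Geometry of Hadamard spaces -/

namespace IsHadamard

variable {X : Type*} [MetricSpace X]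

/-- The point at parameter `t` of a geodesic from `y` to `z`. -/
def geoPt (hX : IsHadamard X) (y z : X) (t : ℝ) : X := (hX.geodesic y z).choose t

variable (hX : IsHadamard X)

lemma geoPt_zero (y z : X) : hX.geoPt y z 0 = y := (hX.geodesic y z).choose_spec.1

lemma geoPt_one (y z : X) : hX.geoPt y z 1 = z := (hX.geodesic y z).choose_spec.2.1

lemma dist_geoPt_geoPt (y z : X) {s t : ℝ} (hs : s ∈ Icc (0:ℝ) 1) (ht : t ∈ Icc (0:ℝ) 1) :
    dist (hX.geoPt y z s) (hX.geoPt y z t) = dist y z * |s - t| :=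
  (hX.geodesic y z).choose_spec.2.2 s hs t ht

lemma dist_left_geoPt (y z : X) {t : ℝ} (ht : t ∈ Icc (0:ℝ) 1) :
    dist y (hX.geoPt y z t) = t * dist y z := by
  have h := hX.dist_geoPt_geoPt y z (left_mem_Icc.2 zero_le_one) ht
  rw [geoPt_zero, zero_sub, abs_neg, abs_of_nonneg ht.1] at h
  rw [h, mul_comm]

lemma dist_geoPt_right (y z : X) {t : ℝ} (ht : t ∈ Icc (0:ℝ) 1) :
    dist (hX.geoPt y z t) z = (1 - t) * dist y z := by
  have h := hX.dist_geoPt_geoPt y z ht (right_mem_Icc.2 zero_le_one)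
  rw [geoPt_one, abs_sub_comm, abs_of_nonneg (sub_nonneg.2 ht.2)] at h
  rw [h, mul_comm]

lemma dist_geoPt_sq_le (w y z : X) {t : ℝ} (ht : t ∈ Icc (0:ℝ) 1) :
    dist w (hX.geoPt y z t) ^ 2 ≤
      (1 - t) * dist w y ^ 2 + t * dist w z ^ 2 - t * (1 - t) * dist y z ^ 2 :=
  hX.cat0 w y z _ (hX.geoPt_zero y z) (hX.geoPt_one y z) (hX.geodesic y z).choose_spec.2.2 t ht

lemma eq_geoPt {q y z : X} {t : ℝ} (ht : t ∈ Icc (0:ℝ) 1) (h₁ : dist y q = t * dist y z)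
    (h₂ : dist q z = (1 - t) * dist y z) : q = hX.geoPt y z t := by
  have h := hX.dist_geoPt_sq_le q y z ht
  rw [dist_comm q y, h₁, h₂] at h
  have h0 : dist q (hX.geoPt y z t) ^ 2 ≤ 0 := h.trans_eq (by ring)
  exact dist_eq_zero.1 (pow_eq_zero_iff two_ne_zero |>.1 (le_antisymm h0 (sq_nonneg _)))

lemma dist_geoPt_le_of_left (x y z : X) {t : ℝ} (ht : t ∈ Icc (0:ℝ) 1) :
    dist (hX.geoPt x y t) (hX.geoPt x z t) ≤ t * dist y z := by
  have h₁ := hX.dist_geoPt_sq_le (hX.geoPt x y t) x z ht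
  have h₂ := hX.dist_geoPt_sq_le z x y ht
  rw [dist_comm _ x, dist_left_geoPt hX x y ht, dist_comm _ z] at h₁
  rw [dist_comm z x, dist_comm z y] at h₂
  refine abs_le_of_sq_le_sq' ?_ (mul_nonneg ht.1 dist_nonneg) |>.2
  nlinarith [mul_le_mul_of_nonneg_left h₂ ht.1]

lemma dist_geoPt_le_of_right (x y z : X) {t : ℝ} (ht : t ∈ Icc (0:ℝ) 1) :
    dist (hX.geoPt x z t) (hX.geoPt y z t) ≤ (1 - t) * dist x y := by
  have h1 : 0 ≤ 1 - t := sub_nonneg.2 ht.2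
  have h₁ := hX.dist_geoPt_sq_le (hX.geoPt x z t) y z ht
  have h₂ := hX.dist_geoPt_sq_le y x z ht
  rw [dist_geoPt_right hX x z ht, dist_comm _ y] at h₁
  rw [dist_comm y x] at h₂
  refine abs_le_of_sq_le_sq' ?_ (mul_nonneg h1 dist_nonneg) |>.2
  nlinarith [mul_le_mul_of_nonneg_left h₂ h1]

lemma geoPt_geoPt (x z : X) {s t : ℝ} (hs : s ∈ Icc (0:ℝ) 1) (ht : t ∈ Icc (0:ℝ) 1) :
    hX.geoPt x (hX.geoPt x z t) s = hX.geoPt x z (s * t) := by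
  have hst : s * t ∈ Icc (0:ℝ) 1 :=
    ⟨mul_nonneg hs.1 ht.1, mul_le_one₀ hs.2 ht.1 ht.2⟩
  refine (hX.eq_geoPt hs ?_ ?_).symm
  · rw [dist_left_geoPt hX x z hst, dist_left_geoPt hX x z ht, mul_assoc]
  · rw [dist_geoPt_geoPt hX x z hst ht, dist_left_geoPt hX x z ht, abs_sub_comm, abs_of_nonneg]
    · ring
    · nlinarith [ht.1, hs.2]

lemma dist_geoPt_le_sqrt_add (x w y z : X) {t : ℝ} (ht : t ∈ Icc (0:ℝ) 1) :
    dist w (hX.geoPt x z t) ≤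
      √((1 - t) * dist w y ^ 2 + t * dist w z ^ 2 - t * (1 - t) * dist y z ^ 2) +
        (1 - t) * dist x y := by
  refine (dist_triangle w (hX.geoPt y z t) _).trans (add_le_add ?_ ?_)
  · exact Real.le_sqrt_of_sq_le (hX.dist_geoPt_sq_le w y z ht)
  · rw [dist_comm]; exact hX.dist_geoPt_le_of_right x y z ht

lemma lipschitzWith_geoPt (x : X) {t : ℝ} (ht : t ∈ Icc (0:ℝ) 1) :
    LipschitzWith 1 (fun z => hX.geoPt x z t) := by
  refine LipschitzWith.of_dist_le_mul fun y z => ?_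
  refine (hX.dist_geoPt_le_of_left x y z ht).trans ?_
  exact mul_le_mul_of_nonneg_right (by simpa using ht.2) dist_nonneg

end IsHadamard

section Rays

variable {X : Type*} [MetricSpace X]

lemma div_mem_unit {s t : ℝ≥0} (h : s ≤ t) : ((s : ℝ) / t) ∈ Icc (0:ℝ) 1 :=
  ⟨by positivity, div_le_one_of_le₀ (by exact_mod_cast h) t.coe_nonneg⟩

lemma ray_eq_geoPt (hX : IsHadamard X) {γ : ℝ≥0 → X} {v : ℝ}
    (hγ : ∀ s t : ℝ≥0, dist (γ s) (γ t) = v * dist s t) {s t : ℝ≥0} (ht : 0 < t) (hst : s ≤ t) :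
    γ s = hX.geoPt (γ 0) (γ t) (s / t) := by
  have ht' : (t : ℝ) ≠ 0 := by exact_mod_cast ht.ne'
  have hst' : (s : ℝ) ≤ t := by exact_mod_cast hst
  refine hX.eq_geoPt (div_mem_unit hst) ?_ ?_
  · rw [hγ, hγ, NNReal.dist_eq, NNReal.dist_eq]
    simp only [NNReal.coe_zero, zero_sub, abs_neg, NNReal.abs_eq]
    field_simp
  · rw [hγ, hγ, NNReal.dist_eq, NNReal.dist_eq, abs_sub_comm,
      abs_of_nonneg (sub_nonneg.2 hst')]
    simp only [NNReal.coe_zero, zero_sub, abs_neg, NNReal.abs_eq]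
    field_simp

/-- Two rays issued from the same point that stay at bounded distance coincide. -/
lemma ray_eq_of_asymptotic (hX : IsHadamard X) {γ β : ℝ≥0 → X} {v w : ℝ}
    (hγ : ∀ s t : ℝ≥0, dist (γ s) (γ t) = v * dist s t)
    (hβ : ∀ s t : ℝ≥0, dist (β s) (β t) = w * dist s t) (h0 : γ 0 = β 0)
    (h : AsymptoticMaps dist γ β) : γ = β := by
  obtain ⟨C, hC⟩ := h
  funext s
  have key : ∀ t : ℝ≥0, 0 < t → s ≤ t → dist (γ s) (β s) ≤ s * C / t := fun t ht hst => by
    rw [ray_eq_geoPt hX hγ ht hst, ray_eq_geoPt hX hβ ht hst, h0]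
    refine (hX.dist_geoPt_le_of_left _ _ _ (div_mem_unit hst)).trans ?_
    rw [mul_div_right_comm]
    exact mul_le_mul_of_nonneg_left (hC t) (by positivity)
  have hlim : Tendsto (fun t : ℝ≥0 => (s * C / t : ℝ)) atTop (𝓝 0) :=
    Tendsto.div_atTop tendsto_const_nhds (NNReal.tendsto_coe_atTop.2 tendsto_id)
  have h0 : dist (γ s) (β s) ≤ 0 := by
    refine ge_of_tendsto hlim ?_
    filter_upwards [eventually_gt_atTop 0, eventually_ge_atTop s] with t h1 h2 using key t h1 h2
  exact dist_le_zero.1 h0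

/-- The point at time `t` on the segment from `x` reaching `z n` at time `2 ^ n`. -/
def approxRay (hX : IsHadamard X) (x : X) (z : ℕ → X) (n : ℕ) (t : ℝ≥0) : X :=
  hX.geoPt x (z n) (min 1 (t / 2 ^ n))

lemma min_one_div_mem (n : ℕ) (t : ℝ≥0) : min 1 ((t : ℝ) / 2 ^ n) ∈ Icc (0:ℝ) 1 :=
  ⟨le_min zero_le_one (by positivity), min_le_left _ _⟩

lemma approxRay_zero (hX : IsHadamard X) (x : X) (z : ℕ → X) (n : ℕ) :
    approxRay hX x z n 0 = x := by
  simp [approxRay, hX.geoPt_zero]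

lemma min_one_div_eq {n : ℕ} {t : ℝ≥0} (h : t ≤ 2 ^ n) :
    min 1 ((t : ℝ) / 2 ^ n) = t / 2 ^ n :=
  min_eq_right (div_le_one_of_le₀ (by exact_mod_cast h) (by positivity))

/-- The rescaled defect between `z n` and the midpoint of `x` and `z (n + 1)`. -/
def rayDefect (hX : IsHadamard X) (x : X) (z : ℕ → X) (n : ℕ) : ℝ :=
  dist (z n) (hX.geoPt x (z (n + 1)) (1 / 2)) / 2 ^ n

lemma dist_approxRay_succ_le (hX : IsHadamard X) (x : X) (z : ℕ → X) {n : ℕ} {t : ℝ≥0}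
    (h : t ≤ 2 ^ n) :
    dist (approxRay hX x z n t) (approxRay hX x z (n + 1) t) ≤ t * rayDefect hX x z n := by
  have h' : t ≤ 2 ^ (n + 1) := h.trans (pow_le_pow_right₀ one_le_two n.le_succ)
  have hm : (t : ℝ) / 2 ^ n ∈ Icc (0:ℝ) 1 := min_one_div_eq h ▸ min_one_div_mem n t
  have e : (t : ℝ) / 2 ^ (n + 1) = t / 2 ^ n * (1 / 2) := by rw [pow_succ]; field_simp
  rw [approxRay, approxRay, min_one_div_eq h, min_one_div_eq h', e,
    ← hX.geoPt_geoPt x _ hm ⟨by norm_num, by norm_num⟩]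
  refine (hX.dist_geoPt_le_of_left _ _ _ hm).trans_eq ?_
  rw [rayDefect]; ring

lemma dist_approxRay (hX : IsHadamard X) (x : X) (z : ℕ → X) {n : ℕ} {s t : ℝ≥0}
    (hs : s ≤ 2 ^ n) (ht : t ≤ 2 ^ n) :
    dist (approxRay hX x z n s) (approxRay hX x z n t) = dist x (z n) / 2 ^ n * dist s t := by
  rw [approxRay, approxRay, hX.dist_geoPt_geoPt _ _ (min_one_div_mem _ _) (min_one_div_mem _ _),
    min_one_div_eq hs, min_one_div_eq ht, NNReal.dist_eq, ← sub_div, abs_div,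
    abs_of_pos (by positivity : (0:ℝ) < 2 ^ n)]
  ring

lemma exists_le_two_pow (t : ℝ≥0) : ∃ n : ℕ, t ≤ 2 ^ n :=
  let ⟨n, hn⟩ := pow_unbounded_of_one_lt t (one_lt_two); ⟨n, hn.le⟩

lemma eventually_le_two_pow (t : ℝ≥0) : ∀ᶠ n : ℕ in atTop, t ≤ 2 ^ n := by
  obtain ⟨n, hn⟩ := exists_le_two_pow t
  filter_upwards [eventually_ge_atTop n] with m hm
  exact hn.trans (pow_le_pow_right₀ one_le_two hm)

/-- If the rescaled defects of a sequence are summable, the approximating segments converge to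
a ray. -/
lemma exists_limit_ray (hX : IsHadamard X) (x : X) (z : ℕ → X)
    (hz : Summable (rayDefect hX x z)) :
    ∃ γ : RaySpace X, γ.1 0 = x ∧
      (∀ t, Tendsto (fun n => approxRay hX x z n t) atTop (𝓝 (γ.1 t))) ∧
      ∀ n, ∀ t ≤ 2 ^ n, dist (approxRay hX x z n t) (γ.1 t) ≤
        t * ∑' k, rayDefect hX x z (n + k) := by
  have := hX.complete
  have hsum : ∀ n, Summable fun k => rayDefect hX x z (n + k) := fun n => by
    simpa only [add_comm] using (summable_nat_add_iff n).2 hz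
  have hstep : ∀ n, ∀ t : ℝ≥0, t ≤ 2 ^ n → ∀ k,
      dist (approxRay hX x z (n + k) t) (approxRay hX x z (n + (k + 1)) t) ≤
        t * rayDefect hX x z (n + k) := fun n t ht k =>
    dist_approxRay_succ_le hX x z (ht.trans (pow_le_pow_right₀ one_le_two (Nat.le_add_right n k)))
  have hlim : ∀ t : ℝ≥0, ∃ p, Tendsto (fun n => approxRay hX x z n t) atTop (𝓝 p) := fun t => by
    obtain ⟨n, hn⟩ := exists_le_two_pow t
    have hc := cauchySeq_of_dist_le_of_summable _ (hstep n t hn) ((hsum n).mul_left _)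
    obtain ⟨p, hp⟩ := cauchySeq_tendsto_of_complete hc
    refine ⟨p, (tendsto_add_atTop_iff_nat n).1 ?_⟩
    simpa only [add_comm] using hp
  choose γ hγ using hlim
  have h0 : γ 0 = x := by
    refine tendsto_nhds_unique (hγ 0) ?_
    simp only [approxRay_zero, tendsto_const_nhds]
  have hspeed : Tendsto (fun n => dist x (z n) / 2 ^ n) atTop (𝓝 (dist (γ 0) (γ 1))) := by
    refine ((hγ 0).dist (hγ 1)).congr fun n => ?_
    rw [dist_approxRay hX x z zero_le (one_le_pow₀ one_le_two), NNReal.dist_eq]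
    simp
  refine ⟨⟨γ, dist (γ 0) (γ 1), dist_nonneg, fun s t => ?_⟩, h0, hγ, fun n t ht => ?_⟩
  · refine tendsto_nhds_unique ((hγ s).dist (hγ t)) ((hspeed.mul_const _).congr' ?_)
    filter_upwards [eventually_le_two_pow s, eventually_le_two_pow t] with n hs ht
    rw [dist_approxRay hX x z hs ht]
  · have := dist_le_tsum_of_dist_le_of_tendsto₀ _ (hstep n t ht) ((hsum n).mul_left _) (a := γ t) ?_
    · simpa [tsum_mul_left] using this
    · have := (tendsto_add_atTop_iff_nat n).2 (hγ t)
      simpa only [add_comm] using this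

end Rays

/-! ## Rays from a base point and the cone at infinity -/

section ConeAtInfinity

variable {X : Type*} [MetricSpace X]

lemma exists_asymptotic_unitRay (hX : IsHadamard X) (x : X) (γ : UnitRay X) :
    ∃ σ : UnitRay X, σ.1 0 = x ∧ (∀ t, dist (σ.1 t) (γ.1 t) ≤ dist x (γ.1 0)) ∧
      ∀ n, ∀ t ≤ 2 ^ n, dist (approxRay hX x (fun k => γ.1 (2 ^ k)) n t) (σ.1 t) ≤
        t * (dist x (γ.1 0) * (1 / 2) ^ n) := by
  set z : ℕ → X := fun k => γ.1 (2 ^ k) with hz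
  have hγ : ∀ s t : ℝ≥0, dist (γ.1 s) (γ.1 t) = 1 * dist s t := fun s t => by
    rw [one_mul, γ.2]
  have hdef : ∀ n, rayDefect hX x z n ≤ dist x (γ.1 0) / 2 * (1 / 2) ^ n := fun n => by
    have hle : (2:ℝ≥0) ^ n ≤ 2 ^ (n + 1) := pow_le_pow_right₀ one_le_two n.le_succ
    have hq : (((2:ℝ≥0) ^ n : ℝ≥0) : ℝ) / ((2:ℝ≥0) ^ (n + 1) : ℝ≥0) = 1 / 2 := by
      push_cast; rw [pow_succ]; field_simp
    have h := hX.dist_geoPt_le_of_right x (γ.1 0) (z (n + 1)) (t := 1 / 2)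
      ⟨by norm_num, by norm_num⟩
    have hzn : z n = hX.geoPt (γ.1 0) (z (n + 1)) (1 / 2) := by
      rw [← hq]
      exact ray_eq_geoPt hX hγ (by positivity) hle
    rw [rayDefect, hzn, dist_comm, one_div_pow]
    calc _ ≤ ((1 - 1 / 2) * dist x (γ.1 0)) / 2 ^ n := by
          gcongr
      _ = _ := by ring
  have hnn : ∀ n, 0 ≤ rayDefect hX x z n := fun n => div_nonneg dist_nonneg (by positivity)
  have hgeo : Summable fun n : ℕ => dist x (γ.1 0) / 2 * (1 / 2 : ℝ) ^ n :=
    summable_geometric_two.mul_left _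
  obtain ⟨σ, hσ0, hσ, hσb⟩ := exists_limit_ray hX x z (hgeo.of_nonneg_of_le hnn hdef)
  have hb : ∀ t, dist (σ.1 t) (γ.1 t) ≤ dist x (γ.1 0) := fun t => by
    refine le_of_tendsto ((hσ t).dist tendsto_const_nhds) ?_
    filter_upwards [eventually_le_two_pow t] with n hn
    have hq : ((t : ℝ) / ((2:ℝ≥0) ^ n : ℝ≥0)) = t / 2 ^ n := by push_cast; rfl
    have hm := div_mem_unit hn
    rw [ray_eq_geoPt hX hγ (by positivity) hn, approxRay, min_one_div_eq hn, ← hq]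
    refine (hX.dist_geoPt_le_of_right _ _ _ hm).trans (mul_le_of_le_one_left dist_nonneg ?_)
    linarith [hm.1]
  obtain ⟨v, hv0, hv⟩ := σ.2
  have hv1 : v = 1 := by
    have key : ∀ t : ℝ≥0, |v - 1| * t ≤ 2 * dist x (γ.1 0) := fun t => by
      have h1 := hv 0 t
      have h2 := γ.2 0 t
      rw [NNReal.dist_eq, NNReal.coe_zero, zero_sub, abs_neg, NNReal.abs_eq] at h1 h2
      have h3 := abs_dist_sub_le (σ.1 0) (γ.1 0) (σ.1 t)
      have h4 := abs_dist_sub_le (σ.1 t) (γ.1 t) (γ.1 0)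
      rw [dist_comm (σ.1 t) (γ.1 0), dist_comm (γ.1 t) (γ.1 0)] at h4
      have h5 := abs_sub_le (dist (σ.1 0) (σ.1 t)) (dist (γ.1 0) (σ.1 t)) (dist (γ.1 0) (γ.1 t))
      have h6 := hb 0
      have h7 := hb t
      rw [h1, h2] at h5
      have : |v - 1| * t = |v * t - t| := by
        rw [← NNReal.abs_eq t, ← abs_mul, NNReal.abs_eq]; ring_nf
      rw [h1] at h3
      rw [h2] at h4
      linarith
    by_contra hne
    have hpos : 0 < |v - 1| := abs_pos.2 (sub_ne_zero.2 hne)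
    have h := key ⟨(2 * dist x (γ.1 0) + 1) / |v - 1|, by positivity⟩
    have h' : |v - 1| * ((2 * dist x (γ.1 0) + 1) / |v - 1|) ≤ 2 * dist x (γ.1 0) := h
    rw [mul_div_cancel₀ _ hpos.ne'] at h'
    linarith
  refine ⟨⟨σ.1, fun s t => by rw [hv, hv1, one_mul]⟩, hσ0, hb, fun n t ht => ?_⟩
  refine (hσb n t ht).trans (mul_le_mul_of_nonneg_left ?_ t.coe_nonneg)
  have hg2 : Summable fun k : ℕ => dist x (γ.1 0) / 2 * (1 / 2 : ℝ) ^ (n + k) := by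
    simpa only [add_comm] using (summable_nat_add_iff n).2 hgeo
  calc ∑' k, rayDefect hX x z (n + k) ≤ ∑' k : ℕ, dist x (γ.1 0) / 2 * (1 / 2 : ℝ) ^ (n + k) :=
        (hg2.of_nonneg_of_le (fun k => hnn _) fun k => hdef _).tsum_le_tsum (fun k => hdef _) hg2
    _ = dist x (γ.1 0) * (1 / 2) ^ n := by
        simp_rw [pow_add, ← mul_assoc]
        rw [tsum_mul_left, tsum_geometric_two]; ring

/-- The unit ray from `x` asymptotic to a given unit ray. -/
def asymRay (hX : IsHadamard X) (x : X) (γ : UnitRay X) : UnitRay X :=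
  (exists_asymptotic_unitRay hX x γ).choose

lemma asymRay_zero (hX : IsHadamard X) (x : X) (γ : UnitRay X) : (asymRay hX x γ).1 0 = x :=
  (exists_asymptotic_unitRay hX x γ).choose_spec.1

lemma asymptoticMaps_asymRay (hX : IsHadamard X) (x : X) (γ : UnitRay X) :
    AsymptoticMaps dist (asymRay hX x γ).1 γ.1 :=
  ⟨_, (exists_asymptotic_unitRay hX x γ).choose_spec.2.1⟩

lemma unitRay_eq_of_asymptotic (hX : IsHadamard X) {γ β : UnitRay X} (h0 : γ.1 0 = β.1 0)
    (h : AsymptoticMaps dist γ.1 β.1) : γ = β :=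
  Subtype.ext (ray_eq_of_asymptotic hX (v := 1) (w := 1) (fun s t => by rw [one_mul, γ.2])
    (fun s t => by rw [one_mul, β.2]) h0 h)

lemma continuous_asymRay (hX : IsHadamard X) (x : X) : Continuous (asymRay hX x) := by
  refine Continuous.subtype_mk (continuous_pi fun t => ?_) _
  have hev : ∀ s : ℝ≥0, Continuous fun γ : UnitRay X => γ.1 s := fun s =>
    (continuous_apply s).comp continuous_subtype_val
  have hloc : TendstoLocallyUniformly
      (fun n (γ : UnitRay X) => approxRay hX x (fun k => γ.1 (2 ^ k)) n t)
      (fun γ => (asymRay hX x γ).1 t) atTop := by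
    rw [Metric.tendstoLocallyUniformly_iff]
    intro ε hε γ
    refine ⟨{β | dist x (β.1 0) < dist x (γ.1 0) + 1}, ?_, ?_⟩
    · exact (isOpen_lt (continuous_const.dist (hev 0)) continuous_const).mem_nhds (by simp)
    · have hlim : Tendsto (fun n : ℕ => (t : ℝ) * ((dist x (γ.1 0) + 1) * (1 / 2) ^ n)) atTop
          (𝓝 0) := by
        have := ((tendsto_pow_atTop_nhds_zero_of_lt_one (r := (1 / 2 : ℝ)) (by norm_num)
          (by norm_num)).const_mul (dist x (γ.1 0) + 1)).const_mul (t : ℝ)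
        simpa using this
      filter_upwards [eventually_le_two_pow t, hlim.eventually (gt_mem_nhds hε)] with n hn hε' β hβ
      rw [dist_comm]
      refine ((exists_asymptotic_unitRay hX x β).choose_spec.2.2 n t hn).trans_lt
        (lt_of_le_of_lt ?_ hε')
      have hβ' : dist x (β.1 0) ≤ dist x (γ.1 0) + 1 := le_of_lt hβ
      gcongr
  refine hloc.continuous (Frequently.of_forall fun n => ?_)
  exact (hX.lipschitzWith_geoPt x (min_one_div_mem n t)).continuous.comp (hev _)

/-- The unit ray from `x` in a given asymptote class. -/
def boundaryRay (hX : IsHadamard X) (x : X) : Boundary X → UnitRay X :=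
  Quotient.lift (asymRay hX x) fun γ β (h : AsymptoticMaps dist γ.1 β.1) => by
    refine unitRay_eq_of_asymptotic hX (by rw [asymRay_zero, asymRay_zero]) ?_
    obtain ⟨C, hC⟩ := asymptoticMaps_asymRay hX x γ
    obtain ⟨C', hC'⟩ := asymptoticMaps_asymRay hX x β
    obtain ⟨K, hK⟩ := h
    refine ⟨C + K + C', fun t => (dist_triangle4 _ (γ.1 t) (β.1 t) _).trans ?_⟩
    exact add_le_add (add_le_add (hC t) (hK t)) (by rw [dist_comm]; exact hC' t)

lemma boundaryRay_zero (hX : IsHadamard X) (x : X) (ξ : Boundary X) :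
    (boundaryRay hX x ξ).1 0 = x := by
  induction ξ using Quotient.ind with
  | _ γ => exact asymRay_zero hX x γ

lemma mk_boundaryRay (hX : IsHadamard X) (x : X) (ξ : Boundary X) :
    Quotient.mk (unitRaySetoid X) (boundaryRay hX x ξ) = ξ := by
  induction ξ using Quotient.ind with
  | _ γ => exact Quotient.sound (asymptoticMaps_asymRay hX x γ)

lemma boundaryRay_mk (hX : IsHadamard X) (x : X) {γ : UnitRay X} (h : γ.1 0 = x) :
    boundaryRay hX x (Quotient.mk _ γ) = γ :=
  unitRay_eq_of_asymptotic hX ((asymRay_zero hX x γ).trans h.symm)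
    (asymptoticMaps_asymRay hX x γ)

lemma continuous_boundaryRay (hX : IsHadamard X) (x : X) : Continuous (boundaryRay hX x) :=
  continuous_quot_lift _ (continuous_asymRay hX x)

/-- The unit ray `γ` travelled at speed `s`. -/
def UnitRay.scale (γ : UnitRay X) (s : ℝ≥0) : RaySpace X :=
  ⟨fun t => γ.1 (s * t), s, s.coe_nonneg, fun a b => by
    rw [γ.2, NNReal.dist_eq, NNReal.dist_eq, NNReal.coe_mul, NNReal.coe_mul, ← mul_sub, abs_mul,
      NNReal.abs_eq]⟩

/-- The constant ray. -/
def constRay (x : X) : RaySpace X := ⟨fun _ => x, 0, le_rfl, fun _ _ => by simp⟩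

lemma UnitRay.scale_zero (γ : UnitRay X) : γ.scale 0 = constRay (γ.1 0) := by
  refine Subtype.ext (funext fun t => ?_)
  simp [UnitRay.scale, constRay]

/-- The ray from `x` with a given end in the cone at infinity. -/
def coneRay (hX : IsHadamard X) (x : X) : Cone (Boundary X) → RaySpace X :=
  Quotient.lift (Sum.elim (fun p => (boundaryRay hX x p.1).scale p.2) fun _ => constRay x) (by
    have key : ∀ p, coneIsApex p →
        Sum.elim (fun p : Boundary X × ℝ≥0 => (boundaryRay hX x p.1).scale p.2)
          (fun _ : Unit => constRay x) p = constRay x := by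
      rintro (⟨ξ, s⟩ | _) h
      · obtain rfl : s = 0 := h
        simp [UnitRay.scale_zero, boundaryRay_zero]
      · rfl
    rintro p q (rfl | ⟨h, h'⟩)
    · rfl
    · rw [key p h, key q h'])

lemma coneRay_coneMk (hX : IsHadamard X) (x : X) (ξ : Boundary X) (s : ℝ≥0) :
    coneRay hX x (coneMk ξ s) = (boundaryRay hX x ξ).scale s := rfl

lemma coneRay_conePt (hX : IsHadamard X) (x : X) :
    coneRay hX x (conePt _) = constRay x := rfl

lemma cone_cases {B : Type*} {p : Cone B → Prop} (h : p (conePt B))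
    (h' : ∀ b s, s ≠ 0 → p (coneMk b s)) (c : Cone B) : p c := by
  induction c using Quotient.ind with
  | _ a =>
    rcases a with ⟨b, s⟩ | u
    · by_cases hs : s = 0
      · subst hs
        have : (Quotient.mk (coneSetoid B) (Sum.inl (b, 0)) : Cone B) = conePt B :=
          Quotient.sound (Or.inr ⟨rfl, trivial⟩)
        rwa [this]
      · exact h' b s hs
    · exact h

lemma coneRay_zero (hX : IsHadamard X) (x : X) (c : Cone (Boundary X)) :
    (coneRay hX x c).1 0 = x := by
  induction c using cone_cases with
  | h => rfl
  | h' ξ s _ => simp [coneRay_coneMk, UnitRay.scale, boundaryRay_zero]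

lemma raySpeed_constRay (x : X) : raySpeed (constRay x) = 0 := by simp [raySpeed, constRay]

lemma UnitRay.raySpeed_scale (γ : UnitRay X) (s : ℝ≥0) : raySpeed (γ.scale s) = s := by
  have h := γ.2 0 s
  rw [NNReal.dist_eq, NNReal.coe_zero, zero_sub, abs_neg, NNReal.abs_eq] at h
  refine NNReal.coe_injective ?_
  simpa [raySpeed, UnitRay.scale] using h

lemma raySpeed_coneRay (hX : IsHadamard X) (x : X) (c : Cone (Boundary X)) :
    raySpeed (coneRay hX x c) = coneSpeed c := by
  induction c using cone_cases with
  | h => exact raySpeed_constRay x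
  | h' ξ s _ => exact UnitRay.raySpeed_scale _ s

lemma rayEnd_coneRay (hX : IsHadamard X) (x : X) (c : Cone (Boundary X)) :
    rayEnd (coneRay hX x c) = c := by
  induction c using cone_cases with
  | h => simp [rayEnd, coneRay_conePt, raySpeed_constRay]
  | h' ξ s hs =>
    have hsp : raySpeed ((boundaryRay hX x ξ).scale s) = s := UnitRay.raySpeed_scale _ s
    rw [coneRay_coneMk, rayEnd, dif_neg (hsp.trans_ne hs)]
    have hu : rayUnit ((boundaryRay hX x ξ).scale s) (hsp.trans_ne hs) = boundaryRay hX x ξ := by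
      refine Subtype.ext (funext fun t => ?_)
      simp only [rayUnit, hsp]
      simp only [UnitRay.scale, mul_div_cancel₀ _ hs]
    rw [hu, mk_boundaryRay, hsp]

lemma coneRay_rayEnd (hX : IsHadamard X) (x : X) {γ : RaySpace X} (h : γ.1 0 = x) :
    coneRay hX x (rayEnd γ) = γ := by
  refine Subtype.ext (funext fun t => ?_)
  by_cases hs : raySpeed γ = 0
  · rw [rayEnd, dif_pos hs, coneRay_conePt]
    obtain ⟨v, hv0, hv⟩ := γ.2
    have hv' : v = 0 := by rw [← raySpeed_eq γ hv0 hv, hs, NNReal.coe_zero]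
    have := hv 0 t
    rw [hv', zero_mul, h] at this
    exact dist_eq_zero.1 this
  · rw [rayEnd, dif_neg hs, coneRay_coneMk, boundaryRay_mk]
    · simp only [UnitRay.scale, rayUnit, mul_div_cancel_left₀ _ hs]
    · simpa [rayUnit] using h

lemma continuous_rayEval (t : ℝ≥0) : Continuous (rayEval t : RaySpace X → X) :=
  (continuous_apply t).comp continuous_subtype_val

lemma continuous_raySpeed : Continuous (raySpeed : RaySpace X → ℝ≥0) :=
  (continuous_rayEval 0).nndist (continuous_rayEval 1)

lemma dist_ray (γ : RaySpace X) (s t : ℝ≥0) :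
    dist (γ.1 s) (γ.1 t) = raySpeed γ * dist s t := by
  obtain ⟨v, hv0, hv⟩ := γ.2
  rw [raySpeed_eq γ hv0 hv, hv]

lemma edist_ray_zero (γ : RaySpace X) (t : ℝ≥0) :
    edist (γ.1 0) (γ.1 t) = t * raySpeed γ := by
  rw [edist_nndist, ← ENNReal.coe_mul, ENNReal.coe_inj]
  refine NNReal.coe_injective ?_
  rw [coe_nndist, dist_ray, NNReal.dist_eq]
  simp [mul_comm]

/-- Joint continuity of the evaluation of rays. -/
lemma continuous_ray_apply : Continuous fun p : RaySpace X × ℝ≥0 => p.1.1 p.2 := by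
  rw [continuous_iff_continuousAt]
  rintro ⟨γ, a⟩
  rw [ContinuousAt, tendsto_iff_dist_tendsto_zero]
  have h1 : Continuous fun p : RaySpace X × ℝ≥0 =>
      raySpeed p.1 * dist p.2 a + dist (p.1.1 a) (γ.1 a) := by
    have e1 := continuous_raySpeed.comp (continuous_fst (X := RaySpace X) (Y := ℝ≥0))
    have e2 := (continuous_rayEval a).comp (continuous_fst (X := RaySpace X) (Y := ℝ≥0))
    exact ((NNReal.continuous_coe.comp e1).mul (continuous_snd.dist continuous_const)).add
      (e2.dist continuous_const)
  refine squeeze_zero (fun _ => dist_nonneg) (fun p => ?_) (h1.tendsto' (γ, a) 0 (by simp))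
  exact (dist_triangle _ (p.1.1 a) _).trans (by rw [dist_ray])

lemma continuous_coneRay (hX : IsHadamard X) (x : X) : Continuous (coneRay hX x) := by
  refine Continuous.quotient_lift (Continuous.sumElim ?_ continuous_const) _
  refine Continuous.subtype_mk (continuous_pi fun t => ?_) _
  let toRay : UnitRay X → RaySpace X := fun γ => ⟨γ.1, 1, zero_le_one, fun s t => by
    rw [one_mul, γ.2]⟩
  have hc : Continuous toRay := Continuous.subtype_mk continuous_subtype_val _
  exact continuous_ray_apply.comp (f := fun p : Boundary X × ℝ≥0 =>
      (toRay (boundaryRay hX x p.1), p.2 * t))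
    ((hc.comp ((continuous_boundaryRay hX x).comp continuous_fst)).prodMk
      (continuous_snd.mul continuous_const))

lemma continuousOn_rayEnd : ContinuousOn (rayEnd : RaySpace X → _) {γ | raySpeed γ ≠ 0} := by
  rw [continuousOn_iff_continuous_domRestrict]
  have hu : Continuous fun γ : {γ : RaySpace X | raySpeed γ ≠ 0} => rayUnit γ.1 γ.2 := by
    refine Continuous.subtype_mk (continuous_pi fun t => ?_) _
    refine continuous_ray_apply.comp (continuous_subtype_val.prodMk ?_)
    exact continuous_const.div₀ (continuous_raySpeed.comp continuous_subtype_val) fun γ => γ.2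
  have h : Continuous fun γ : {γ : RaySpace X | raySpeed γ ≠ 0} =>
      coneMk (Quotient.mk (unitRaySetoid X) (rayUnit γ.1 γ.2)) (raySpeed γ.1) :=
    continuous_quotient_mk'.comp (continuous_inl.comp
      ((continuous_quotient_mk'.comp hu).prodMk (continuous_raySpeed.comp continuous_subtype_val)))
  refine h.congr fun γ => ?_
  rw [domRestrict_apply, rayEnd, dif_neg γ.2]

/-- The topology of the space of rays is determined by evaluations at integer times. -/
lemma isInducing_rayEval_nat (hX : IsHadamard X) :
    IsInducing fun (γ : RaySpace X) (n : ℕ) => rayEval (n : ℝ≥0) γ := by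
  rw [isInducing_iff_nhds]
  intro γ
  refine le_antisymm ?_ ?_
  · exact (continuous_pi fun n : ℕ => continuous_rayEval (n : ℝ≥0)).continuousAt.tendsto.le_comap
  · rw [nhds_subtype_eq_comap, ← tendsto_iff_comap, tendsto_pi_nhds]
    intro t
    set l := comap (fun (γ : RaySpace X) (n : ℕ) => rayEval (n : ℝ≥0) γ)
      (𝓝 fun n : ℕ => rayEval (n : ℝ≥0) γ)
    have hn : ∀ n : ℕ, Tendsto (fun β : RaySpace X => dist (β.1 n) (γ.1 n)) l (𝓝 0) := fun n => by
      have hc : Tendsto (fun (β : RaySpace X) (n : ℕ) => rayEval (n : ℝ≥0) β) l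
        (𝓝 fun n : ℕ => rayEval (n : ℝ≥0) γ) := tendsto_comap
      exact tendsto_iff_dist_tendsto_zero.1 (tendsto_pi_nhds.1 hc n)
    obtain ⟨N, hN⟩ := exists_nat_ge (max t 1)
    have htN : t ≤ N := (le_max_left _ _).trans hN
    have hN0 : (0 : ℝ≥0) < N := zero_lt_one.trans_le ((le_max_right _ _).trans hN)
    have hm := div_mem_unit htN
    rw [tendsto_iff_dist_tendsto_zero]
    refine squeeze_zero (fun _ => dist_nonneg) (fun β => ?_)
      (by simpa using (hn 0).add (hn N))
    rw [ray_eq_geoPt hX (dist_ray β) hN0 htN, ray_eq_geoPt hX (dist_ray γ) hN0 htN]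
    refine (dist_triangle _ (hX.geoPt (γ.1 0) (β.1 N) (t / (N : ℝ≥0))) _).trans (add_le_add ?_ ?_)
    · refine (hX.dist_geoPt_le_of_right _ _ _ hm).trans ?_
      exact mul_le_of_le_one_left dist_nonneg (by linarith [hm.1])
    · exact (hX.dist_geoPt_le_of_left _ _ _ hm).trans (mul_le_of_le_one_left dist_nonneg hm.2)

variable [MeasurableSpace X]

lemma measurable_rayEval (t : ℝ≥0) : Measurable (rayEval t : RaySpace X → X) :=
  (measurable_pi_apply t).comp measurable_subtype_coe

variable [BorelSpace X]

lemma opensMeasurableSpace_raySpace (hX : IsHadamard X) : OpensMeasurableSpace (RaySpace X) := by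
  have := hX.separable
  have : SecondCountableTopology X := UniformSpace.secondCountable_of_separable X
  refine ⟨MeasurableSpace.generateFrom_le fun U hU => ?_⟩
  obtain ⟨V, hV, rfl⟩ := (isInducing_rayEval_nat hX).isOpen_iff.1 hU
  exact (measurable_pi_lambda _ fun n => measurable_rayEval _) hV.measurableSet

lemma measurable_rayEnd (hX : IsHadamard X) : Measurable (rayEnd : RaySpace X → _) := by
  classical
  have := opensMeasurableSpace_raySpace hX
  have hopen : IsOpen {γ : RaySpace X | raySpeed γ ≠ 0} :=
    isOpen_ne_fun continuous_raySpeed continuous_const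
  have h0 : ContinuousOn (rayEnd : RaySpace X → _) {γ | raySpeed γ ≠ 0}ᶜ := by
    refine (continuousOn_const (c := conePt (Boundary X))).congr fun γ hγ => ?_
    have hγ' : raySpeed γ = 0 := by simpa using hγ
    rw [rayEnd, dif_pos hγ']
  have := continuousOn_rayEnd.measurable_piecewise h0 hopen.measurableSet
  rwa [piecewise_same] at this

lemma measurable_coneRay (hX : IsHadamard X) (x : X) : Measurable (coneRay hX x) :=
  (measurable_pi_lambda _ fun t =>
    ((continuous_rayEval t).comp (continuous_coneRay hX x)).measurable).subtype_mk

end ConeAtInfinity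

/-! ## Gluing of couplings -/

section Gluing

open ProbabilityTheory

lemma map_compProd_comap {A B C : Type*} [MeasurableSpace A] [MeasurableSpace B]
    [MeasurableSpace C] (ρ : Measure A) [IsProbabilityMeasure ρ] {f : A → B} (hf : Measurable f)
    (κ : Kernel B C) [IsMarkovKernel κ] :
    (ρ ⊗ₘ κ.comap f hf).map (fun p => (f p.1, p.2)) = ρ.map f ⊗ₘ κ := by
  have hm : Measurable fun p : A × C => (f p.1, p.2) := by fun_prop
  have := Measure.isProbabilityMeasure_map (μ := ρ) hf.aemeasurable
  ext s hs
  rw [Measure.map_apply hm hs, Measure.compProd_apply (hm hs), Measure.compProd_apply hs,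
    lintegral_map (Kernel.measurable_kernel_prodMk_left hs) hf]
  rfl

variable {Y : Type*} [MeasurableSpace Y] [StandardBorelSpace Y] [Nonempty Y]

lemma IsCoupling.isProbabilityMeasure {A B : Type*} [MeasurableSpace A] [MeasurableSpace B]
    {π : Measure (A × B)} {μ : Measure A} {ν : Measure B} [IsProbabilityMeasure μ]
    (h : IsCoupling π μ ν) : IsProbabilityMeasure π := by
  have : IsProbabilityMeasure (π.map Prod.fst) := by rw [h.1]; infer_instance
  exact (Measure.isProbabilityMeasure_map_iff measurable_fst.aemeasurable).1 this

/-- Successive couplings of a sequence of probability measures are realized by a Markov chain. -/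
lemma exists_markov_chain (μ : ℕ → Measure Y) [∀ n, IsProbabilityMeasure (μ n)]
    (π : ℕ → Measure (Y × Y)) (hπ : ∀ n, IsCoupling (π n) (μ n) (μ (n + 1))) :
    ∃ P : Measure (ℕ → Y), IsProbabilityMeasure P ∧
      ∀ n, P.map (fun ω => (ω n, ω (n + 1))) = π n := by
  have hp : ∀ n, IsProbabilityMeasure (π n) := fun n => (hπ n).isProbabilityMeasure
  let f : (n : ℕ) → ((i : Finset.Iic n) → Y) → Y := fun n ω => ω ⟨n, Finset.mem_Iic.2 le_rfl⟩
  have hf : ∀ n, Measurable (f n) := fun n => measurable_pi_apply _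
  let κ : (n : ℕ) → Kernel ((i : Finset.Iic n) → (fun _ : ℕ => Y) i) ((fun _ : ℕ => Y) (n + 1)) :=
    fun n => (π n).condKernel.comap (f n) (hf n)
  have hκ : ∀ n, IsMarkovKernel (κ n) := fun n => Kernel.IsMarkovKernel.comap _ (hf n)
  let P : Measure (ℕ → Y) := Kernel.trajMeasure (X := fun _ => Y) (μ 0) κ
  have hP : IsProbabilityMeasure P := by
    dsimp only [P]; infer_instance
  have hr : ∀ n, Measurable (Preorder.frestrictLe (π := fun _ : ℕ => Y) n) := fun n =>
    Preorder.measurable_frestrictLe n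
  have hpair : ∀ n, P.map (fun ω => ω n) = μ n →
      P.map (fun ω => (ω n, ω (n + 1))) = π n := fun n hn => by
    have h := Kernel.map_frestrictLe_trajMeasure_compProd_eq_map_trajMeasure
      (X := fun _ => Y) (κ := κ) (μ₀ := μ 0) (a := n)
    have hprob : IsProbabilityMeasure (P.map (Preorder.frestrictLe n)) :=
      Measure.isProbabilityMeasure_map (hr n).aemeasurable
    have h2 := congrArg (Measure.map fun p : ((i : Finset.Iic n) → Y) × Y => (f n p.1, p.2)) h
    rw [Measure.map_map (by fun_prop) (by fun_prop)] at h2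
    have h3 := map_compProd_comap (P.map (Preorder.frestrictLe n)) (hf n) (π n).condKernel
    rw [Measure.map_map (hf n) (hr n)] at h3
    have e1 : P.map (f n ∘ Preorder.frestrictLe n) = (π n).fst := hn.trans (hπ n).1.symm
    rw [e1, (π n).disintegrate] at h3
    exact h2.symm.trans h3
  have h0 : P.map (fun ω => ω 0) = μ 0 := by
    have e : P.map (Preorder.frestrictLe 0) =
        (μ 0).map (MeasurableEquiv.piUnique (fun _ : Finset.Iic 0 => Y)).symm := by
      dsimp only [P]
      rw [Kernel.trajMeasure, Measure.map_comp _ _ (hr 0), Kernel.traj_map_frestrictLe,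
        Kernel.partialTraj_self, Measure.id_comp]
    have e2 := congrArg (Measure.map (f 0)) e
    rw [Measure.map_map (hf 0) (hr 0), Measure.map_map (hf 0) (MeasurableEquiv.measurable _)] at e2
    refine (e2 : P.map (fun ω => ω 0) = _).trans ?_
    have e3 : f 0 ∘ (MeasurableEquiv.piUnique (fun _ : Finset.Iic 0 => Y)).symm = id := by
      funext y
      exact (MeasurableEquiv.piUnique (fun _ : Finset.Iic 0 => Y)).apply_symm_apply y
    rw [e3, Measure.map_id]
  have hn : ∀ n, P.map (fun ω => ω n) = μ n := fun n => by
    induction n with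
    | zero => exact h0
    | succ n ih =>
      have h := congrArg (Measure.map Prod.snd) (hpair n ih)
      rw [Measure.map_map measurable_snd (by fun_prop)] at h
      exact (h : P.map (fun ω => ω (n + 1)) = _).trans (hπ n).2
  exact ⟨P, hP, fun n => hpair n (hn n)⟩

/-- Two couplings with a common marginal can be glued. -/
lemma exists_gluing {μ ν ρ : Measure Y} [IsProbabilityMeasure μ] [IsProbabilityMeasure ν]
    {π₁ π₂ : Measure (Y × Y)} (h₁ : IsCoupling π₁ μ ν) (h₂ : IsCoupling π₂ ν ρ) :
    ∃ P : Measure ((Y × Y) × Y), IsProbabilityMeasure P ∧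
      P.map Prod.fst = π₁ ∧ P.map (fun p => (p.1.2, p.2)) = π₂ := by
  have := h₁.isProbabilityMeasure
  have := h₂.isProbabilityMeasure
  refine ⟨π₁ ⊗ₘ π₂.condKernel.comap Prod.snd measurable_snd, inferInstance,
    Measure.fst_compProd _ _, ?_⟩
  have h := map_compProd_comap π₁ measurable_snd π₂.condKernel
  have e : π₁.map Prod.snd = π₂.fst := h₁.2.trans h₂.1.symm
  rw [e, π₂.disintegrate] at h
  exact h

end Gluing

/-! ## The quadratic mean -/

/-- The quadratic mean of an extended nonnegative function. -/
def l2 {Ω : Type*} [MeasurableSpace Ω] (P : Measure Ω) (f : Ω → ℝ≥0∞) : ℝ≥0∞ :=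
  (∫⁻ ω, f ω ^ 2 ∂P) ^ (1 / 2 : ℝ)

section QuadraticMean

variable {Ω : Type*} [MeasurableSpace Ω] {P : Measure Ω} {f g : Ω → ℝ≥0∞}

lemma ENNReal.sq_rpow_half (a : ℝ≥0∞) : (a ^ 2) ^ (1 / 2 : ℝ) = a := by
  rw [← ENNReal.rpow_natCast, ← ENNReal.rpow_mul]
  norm_num

lemma ENNReal.rpow_half_sq (a : ℝ≥0∞) : (a ^ (1 / 2 : ℝ)) ^ 2 = a := by
  rw [← ENNReal.rpow_natCast, ← ENNReal.rpow_mul]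
  norm_num

lemma l2_sq : l2 P f ^ 2 = ∫⁻ ω, f ω ^ 2 ∂P := ENNReal.rpow_half_sq _

lemma l2_mono_ae (h : ∀ᵐ ω ∂P, f ω ≤ g ω) : l2 P f ≤ l2 P g := by
  refine ENNReal.rpow_le_rpow (lintegral_mono_ae ?_) (by norm_num)
  filter_upwards [h] with ω hω
  gcongr

lemma l2_mono (h : ∀ ω, f ω ≤ g ω) : l2 P f ≤ l2 P g := l2_mono_ae (ae_of_all _ h)

lemma l2_congr_ae (h : ∀ᵐ ω ∂P, f ω = g ω) : l2 P f = l2 P g :=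
  le_antisymm (l2_mono_ae (h.mono fun _ h => h.le)) (l2_mono_ae (h.mono fun _ h => h.ge))

lemma l2_add_le (hf : Measurable f) (hg : Measurable g) :
    l2 P (fun ω => f ω + g ω) ≤ l2 P f + l2 P g := by
  have h := ENNReal.lintegral_Lp_add_le (μ := P) (p := 2) hf.aemeasurable hg.aemeasurable
    (by norm_num)
  simp only [Pi.add_apply, ENNReal.rpow_two] at h
  exact h

lemma l2_const_mul (c : ℝ≥0∞) (hf : Measurable f) : l2 P (fun ω => c * f ω) = c * l2 P f := by
  simp only [l2, mul_pow]
  rw [lintegral_const_mul _ (by fun_prop), ENNReal.mul_rpow_of_nonneg _ _ (by norm_num),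
    ENNReal.sq_rpow_half]

lemma l2_map {Ω' : Type*} [MeasurableSpace Ω'] {φ : Ω → Ω'} (hφ : Measurable φ) {f : Ω' → ℝ≥0∞}
    (hf : Measurable f) : l2 (P.map φ) f = l2 P (fun ω => f (φ ω)) := by
  rw [l2, lintegral_map (by fun_prop) hφ, l2]

lemma l2_le_of_sq_le {r : ℝ≥0∞} (h : ∫⁻ ω, f ω ^ 2 ∂P ≤ r ^ 2) : l2 P f ≤ r := by
  rw [← ENNReal.sq_rpow_half r]
  exact ENNReal.rpow_le_rpow h (by norm_num)

lemma l2_sum_le {F : ℕ → Ω → ℝ≥0∞} (hF : ∀ n, Measurable (F n)) (N : ℕ) :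
    l2 P (fun ω => ∑ k ∈ Finset.range N, F k ω) ≤ ∑ k ∈ Finset.range N, l2 P (F k) := by
  induction N with
  | zero => simp [l2]
  | succ N ih =>
    simp only [Finset.sum_range_succ]
    exact (l2_add_le (by fun_prop) (hF N)).trans (by gcongr)

lemma l2_tsum_le {F : ℕ → Ω → ℝ≥0∞} (hF : ∀ n, Measurable (F n)) :
    l2 P (fun ω => ∑' k, F k ω) ≤ ∑' k, l2 P (F k) := by
  refine l2_le_of_sq_le ?_
  have hlim : ∀ ω, (∑' k, F k ω) ^ 2 =
      liminf (fun N => (∑ k ∈ Finset.range N, F k ω) ^ 2) atTop := fun ω =>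
    (((ENNReal.continuous_pow 2).tendsto _).comp
      ENNReal.summable.hasSum.tendsto_sum_nat).liminf_eq.symm
  simp only [hlim]
  refine (lintegral_liminf_le fun N => by fun_prop).trans ?_
  refine liminf_le_of_frequently_le' (Frequently.of_forall fun N => ?_)
  rw [← l2_sq]
  gcongr
  exact (l2_sum_le hF N).trans (ENNReal.sum_le_tsum _)

end QuadraticMean

/-! ## The Wasserstein distance -/

/-- The Wasserstein distance between two measures, as an extended real number. -/
def wEDist {Y : Type*} [MetricSpace Y] [MeasurableSpace Y] (μ ν : Measure Y) : ℝ≥0∞ :=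
  W2cost μ ν ^ (1 / 2 : ℝ)

section Wasserstein

variable {Y : Type*} [MetricSpace Y] [MeasurableSpace Y] {μ ν ρ : Measure Y}

lemma Wdist_eq_toReal (μ ν : W2Space Y) : Wdist μ ν = (wEDist μ.1 ν.1).toReal := by
  rw [Wdist, wEDist, Real.sqrt_eq_rpow, ENNReal.toReal_rpow]

lemma W2cost_le {π : Measure (Y × Y)} (h : IsCoupling π μ ν) :
    W2cost μ ν ≤ ∫⁻ p, edist p.1 p.2 ^ 2 ∂π := by
  simp only [W2cost, ← edist_dist]
  exact iInf₂_le π h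

lemma wEDist_le {π : Measure (Y × Y)} (h : IsCoupling π μ ν) :
    wEDist μ ν ≤ l2 π (fun p => edist p.1 p.2) :=
  ENNReal.rpow_le_rpow (W2cost_le h) (by norm_num)

lemma exists_coupling_l2_lt {r : ℝ≥0∞} (h : wEDist μ ν < r) :
    ∃ π, IsCoupling π μ ν ∧ l2 π (fun p => edist p.1 p.2) < r := by
  have h' : W2cost μ ν < r ^ 2 := by
    rw [← ENNReal.rpow_half_sq (W2cost μ ν)]
    exact ENNReal.pow_lt_pow_left (by norm_num) h
  simp only [W2cost, ← edist_dist, iInf_lt_iff] at h'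
  obtain ⟨π, hπ, hlt⟩ := h'
  refine ⟨π, hπ, ?_⟩
  rw [← ENNReal.sq_rpow_half r]
  exact ENNReal.rpow_lt_rpow hlt (by norm_num)

lemma isCoupling_map {Ω A B : Type*} [MeasurableSpace Ω] [MeasurableSpace A] [MeasurableSpace B]
    (P : Measure Ω) {f : Ω → A} {g : Ω → B} (hf : Measurable f) (hg : Measurable g) :
    IsCoupling (P.map fun ω => (f ω, g ω)) (P.map f) (P.map g) := by
  constructor
  · rw [Measure.map_map measurable_fst (by fun_prop)]; rfl
  · rw [Measure.map_map measurable_snd (by fun_prop)]; rfl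

lemma wEDist_comm (μ ν : Measure Y) : wEDist μ ν = wEDist ν μ := by
  have key : ∀ μ ν : Measure Y, W2cost μ ν ≤ W2cost ν μ := fun μ ν => by
    refine le_iInf₂ fun π hπ => ?_
    have hc : IsCoupling (π.map MeasurableEquiv.prodComm) μ ν := by
      constructor
      · rw [Measure.map_map measurable_fst (MeasurableEquiv.measurable _)]; exact hπ.2
      · rw [Measure.map_map measurable_snd (MeasurableEquiv.measurable _)]; exact hπ.1
    refine (W2cost_le hc).trans ?_
    rw [lintegral_map_equiv]
    refine (lintegral_congr fun p => ?_).le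
    rw [← edist_dist, edist_comm]
    rfl
  rw [wEDist, wEDist, le_antisymm (key μ ν) (key ν μ)]

variable [SecondCountableTopology Y] [BorelSpace Y]

lemma wEDist_map_le {Ω : Type*} [MeasurableSpace Ω] (P : Measure Ω) {f g : Ω → Y}
    (hf : Measurable f) (hg : Measurable g) :
    wEDist (P.map f) (P.map g) ≤ l2 P (fun ω => edist (f ω) (g ω)) := by
  refine (wEDist_le (isCoupling_map P hf hg)).trans ?_
  rw [l2_map (by fun_prop) (by fun_prop)]

lemma wEDist_self (μ : Measure Y) : wEDist μ μ = 0 := by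
  have h := wEDist_map_le μ (f := id) (g := id) measurable_id measurable_id
  simpa [l2] using h

lemma wEDist_dirac (x : Y) (μ : Measure Y) [IsProbabilityMeasure μ] :
    wEDist (Measure.dirac x) μ = l2 μ (fun y => edist x y) := by
  apply le_antisymm
  · have h := wEDist_map_le μ (f := fun _ => x) (g := id) (by fun_prop) measurable_id
    rw [Measure.map_const, measure_univ, one_smul, Measure.map_id] at h
    exact h
  · by_contra! hlt
    obtain ⟨π, hπ, hlt⟩ := exists_coupling_l2_lt hlt
    refine hlt.ne' ?_
    have hx : ∀ᵐ p ∂π, p.1 = x := by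
      refine ae_of_ae_map (p := fun y => y = x) measurable_fst.aemeasurable ?_
      rw [hπ.1]
      exact (ae_dirac_iff (measurableSet_singleton x)).2 rfl
    rw [← hπ.2, l2_map measurable_snd (by fun_prop)]
    exact l2_congr_ae (hx.mono fun p hp => by rw [hp])

lemma wEDist_triangle [CompleteSpace Y] (μ ν ρ : Measure Y) [IsProbabilityMeasure μ]
    [IsProbabilityMeasure ν] : wEDist μ ρ ≤ wEDist μ ν + wEDist ν ρ := by
  have : Nonempty Y := nonempty_of_isProbabilityMeasure μ
  refine ENNReal.le_of_forall_pos_le_add fun ε hε h => ?_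
  have hε2 : ((ε / 2 : ℝ≥0) : ℝ≥0∞) ≠ 0 := by simpa using hε.ne'
  obtain ⟨h1, h2⟩ := ENNReal.add_lt_top.1 h
  obtain ⟨π₁, hπ₁, hl₁⟩ := exists_coupling_l2_lt (ENNReal.lt_add_right h1.ne hε2)
  obtain ⟨π₂, hπ₂, hl₂⟩ := exists_coupling_l2_lt (ENNReal.lt_add_right h2.ne hε2)
  obtain ⟨P, hP, e₁, e₂⟩ := exists_gluing hπ₁ hπ₂
  have hμ : P.map (fun p => p.1.1) = μ := by
    rw [← hπ₁.1, ← e₁, Measure.map_map measurable_fst measurable_fst]; rfl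
  have hρ : P.map (fun p => p.2) = ρ := by
    rw [← hπ₂.2, ← e₂, Measure.map_map measurable_snd (by fun_prop)]; rfl
  rw [← e₁, l2_map measurable_fst (by fun_prop)] at hl₁
  rw [← e₂, l2_map (by fun_prop) (by fun_prop)] at hl₂
  calc wEDist μ ρ ≤ l2 P (fun p => edist p.1.1 p.2) := by
        rw [← hμ, ← hρ]; exact wEDist_map_le P (by fun_prop) (by fun_prop)
    _ ≤ l2 P (fun p => edist p.1.1 p.1.2 + edist p.1.2 p.2) :=
        l2_mono fun p => edist_triangle _ _ _
    _ ≤ l2 P (fun p => edist p.1.1 p.1.2) + l2 P (fun p => edist p.1.2 p.2) :=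
        l2_add_le (by fun_prop) (by fun_prop)
    _ ≤ (wEDist μ ν + (ε / 2 : ℝ≥0)) + (wEDist ν ρ + (ε / 2 : ℝ≥0)) :=
        add_le_add hl₁.le hl₂.le
    _ = wEDist μ ν + wEDist ν ρ + ((ε / 2 + ε / 2 : ℝ≥0) : ℝ≥0∞) := by
        rw [ENNReal.coe_add]; ring
    _ = wEDist μ ν + wEDist ν ρ + ε := by rw [add_halves]

lemma eq_of_wEDist_eq_zero [IsProbabilityMeasure μ] [IsProbabilityMeasure ν]
    (h : wEDist μ ν = 0) : μ = ν := by
  have key : ∀ μ ν : Measure Y, wEDist μ ν = 0 → ∀ [IsProbabilityMeasure μ]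
      [IsProbabilityMeasure ν] (F : Set Y), IsClosed F → μ F ≤ ν F := by
    intro μ ν h _ _ F hF
    have hthick : ∀ δ : ℝ, 0 < δ → μ F ≤ ν (Metric.thickening δ F) := by
      intro δ hδ
      refine ENNReal.le_of_forall_pos_le_add fun ε hε _ => ?_
      have hr : (0 : ℝ≥0∞) < ENNReal.ofReal δ * (ε : ℝ≥0∞) ^ (1 / 2 : ℝ) := by
        have h1 : (0 : ℝ≥0∞) < (ε : ℝ≥0∞) ^ (1 / 2 : ℝ) :=
          ENNReal.rpow_pos (by exact_mod_cast hε) (by simp)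
        exact ENNReal.mul_pos (by simpa using hδ) h1.ne'
      obtain ⟨π, hπ, hl⟩ := exists_coupling_l2_lt (h.trans_lt hr)
      have h_int : ∫⁻ p, edist p.1 p.2 ^ 2 ∂π ≤ ENNReal.ofReal δ ^ 2 * ε := by
        rw [← l2_sq]
        calc _ ≤ (ENNReal.ofReal δ * (ε : ℝ≥0∞) ^ (1 / 2 : ℝ)) ^ 2 := by gcongr
          _ = _ := by rw [mul_pow, ENNReal.rpow_half_sq]
      have hcheb : π {p | ENNReal.ofReal δ ^ 2 ≤ edist p.1 p.2 ^ 2} ≤ ε := by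
        have hδ2 : ENNReal.ofReal δ ^ 2 ≠ 0 := by simpa using hδ
        refine (meas_ge_le_lintegral_div (by fun_prop) hδ2 (by simp)).trans ?_
        refine ENNReal.div_le_of_le_mul ?_
        rwa [mul_comm]
      have hF' : μ F = π (Prod.fst ⁻¹' F) := by
        rw [← hπ.1, Measure.map_apply measurable_fst hF.measurableSet]
      have hT : ν (Metric.thickening δ F) = π (Prod.snd ⁻¹' Metric.thickening δ F) := by
        rw [← hπ.2, Measure.map_apply measurable_snd Metric.isOpen_thickening.measurableSet]
      rw [hF', hT]
      refine (measure_mono ?_).trans ((measure_union_le _ _).trans (add_le_add le_rfl hcheb))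
      intro p hp
      by_cases hd : dist p.1 p.2 < δ
      · left
        exact Metric.mem_thickening_iff.2 ⟨p.1, hp, by rwa [dist_comm]⟩
      · right
        simp only [mem_ofPred_eq, edist_dist]
        gcongr
        exact not_lt.1 hd
    have hlim := tendsto_measure_thickening_of_isClosed (μ := ν)
      ⟨1, one_pos, measure_ne_top _ _⟩ hF
    exact ge_of_tendsto hlim (eventually_nhdsWithin_of_forall fun δ hδ => hthick δ hδ)
  refine ext_of_generate_finite _ (BorelSpace.measurable_eq.trans borel_eq_generateFrom_isClosed)
    isPiSystem_isClosed (fun F hF => ?_) (by simp)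
  exact le_antisymm (key μ ν h F hF) (key ν μ (by rwa [wEDist_comm]) F hF)

lemma wEDist_lt_top [CompleteSpace Y] (μ ν : W2Space Y) : wEDist μ.1 ν.1 < ⊤ := by
  obtain ⟨μ, hμ, a, ha⟩ := μ
  obtain ⟨ν, hν, b, hb⟩ := ν
  simp only [← edist_dist] at ha hb
  have key : ∀ (c : Y) (ρ : Measure Y), IsProbabilityMeasure ρ → ∫⁻ y, edist c y ^ 2 ∂ρ < ⊤ →
      wEDist (Measure.dirac c) ρ < ⊤ := fun c ρ _ h => by
    rw [wEDist_dirac]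
    exact ENNReal.rpow_lt_top_of_nonneg (by norm_num) h.ne
  have hab : wEDist (Measure.dirac a) (Measure.dirac b) < ⊤ := by
    rw [wEDist_dirac, l2, lintegral_dirac' _ (by fun_prop), ENNReal.sq_rpow_half]
    exact edist_lt_top a b
  refine (wEDist_triangle μ (Measure.dirac a) ν).trans_lt (ENNReal.add_lt_top.2 ⟨?_, ?_⟩)
  · rw [wEDist_comm]; exact key a μ hμ ha
  · exact (wEDist_triangle _ (Measure.dirac b) ν).trans_lt
      (ENNReal.add_lt_top.2 ⟨hab, key b ν hν hb⟩)

lemma ofReal_Wdist [CompleteSpace Y] (μ ν : W2Space Y) :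
    ENNReal.ofReal (Wdist μ ν) = wEDist μ.1 ν.1 := by
  rw [Wdist_eq_toReal, ENNReal.ofReal_toReal (wEDist_lt_top μ ν).ne]

/-- A `K`-Lipschitz map of `Y` induces a `K`-Lipschitz map of measures. -/
lemma wEDist_map_map_le {K : ℝ≥0∞} {h : Y → Y} (hm : Measurable h)
    (hK : ∀ y z, edist (h y) (h z) ≤ K * edist y z) (μ ν : Measure Y) (hfin : wEDist μ ν ≠ ⊤)
    (hKt : K ≠ ⊤) : wEDist (μ.map h) (ν.map h) ≤ K * wEDist μ ν := by
  refine ENNReal.le_of_forall_pos_le_add fun ε hε _ => ?_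
  have hK0 : (ε : ℝ≥0∞) / (K + 1) ≠ 0 := by
    simp [hε.ne', hKt]
  obtain ⟨π, hπ, hl⟩ := exists_coupling_l2_lt (ENNReal.lt_add_right hfin hK0)
  calc wEDist (μ.map h) (ν.map h)
      = wEDist (π.map fun p => h p.1) (π.map fun p => h p.2) := by
        rw [← hπ.1, ← hπ.2, Measure.map_map hm measurable_fst, Measure.map_map hm measurable_snd]
        rfl
    _ ≤ l2 π (fun p => edist (h p.1) (h p.2)) := wEDist_map_le π (by fun_prop) (by fun_prop)
    _ ≤ l2 π (fun p => K * edist p.1 p.2) := l2_mono fun p => hK _ _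
    _ = K * l2 π (fun p => edist p.1 p.2) := l2_const_mul K (by fun_prop)
    _ ≤ K * (wEDist μ ν + ε / (K + 1)) := by gcongr
    _ = K * wEDist μ ν + ε * (K / (K + 1)) := by
        rw [mul_add]; congr 1; rw [div_eq_mul_inv, div_eq_mul_inv]; ring
    _ ≤ K * wEDist μ ν + ε := by
        gcongr
        exact mul_le_of_le_one_right' (ENNReal.div_le_of_le_mul (by simp))

end Wasserstein

/-! ## Geodesics of the Wasserstein space -/

section WassersteinRays

variable {X : Type*} [MetricSpace X] [MeasurableSpace X] [BorelSpace X]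

lemma IsHadamard.measurable_geoPt (hX : IsHadamard X) (x : X) {t : ℝ} (ht : t ∈ Icc (0:ℝ) 1) :
    Measurable fun z => hX.geoPt x z t :=
  (hX.lipschitzWith_geoPt x ht).continuous.measurable

variable [CompleteSpace X] [SecondCountableTopology X]

/-- If `μ₀`, `μ₁`, `μ₂` are aligned in the Wasserstein space, then the contraction towards `x`
of ratio `t / T` moves `μ₂` to a measure whose distance to `μ₁` is at most that of `μ₀` to the
Dirac mass at `x`. -/
lemma exists_coupling_contraction (hX : IsHadamard X) (x : X) {μ₀ μ₁ μ₂ : Measure X}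
    [IsProbabilityMeasure μ₀] [IsProbabilityMeasure μ₁] {t T : ℝ≥0} (hT : 0 < T) (htT : t ≤ T)
    (h₀₁ : wEDist μ₀ μ₁ = t) (h₁₂ : wEDist μ₁ μ₂ = (T - t : ℝ≥0)) (h₀₂ : wEDist μ₀ μ₂ = T)
    {η : ℝ≥0} (hη : 0 < η) :
    ∃ π, IsCoupling π μ₁ μ₂ ∧
      l2 π (fun p => edist p.1 (hX.geoPt x p.2 (t / T))) ≤ wEDist (Measure.dirac x) μ₀ + η := by
  have : Nonempty X := ⟨x⟩
  have hl := div_mem_unit htT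
  set l : ℝ := t / T with hl_def
  have hT' : (0 : ℝ) < T := by exact_mod_cast hT
  have htT' : (t : ℝ) ≤ T := by exact_mod_cast htT
  have hη' : (0 : ℝ) < η := by exact_mod_cast hη
  obtain ⟨ε, hε, hεη⟩ : ∃ ε : ℝ≥0, 0 < ε ∧
      (1 - l) * (t + ε : ℝ) ^ 2 + l * (T - t + ε : ℝ) ^ 2 < l * (1 - l) * T ^ 2 + η ^ 2 := by
    have hc : Continuous fun ε : ℝ≥0 =>
        (1 - l) * (t + ε : ℝ) ^ 2 + l * (T - t + ε : ℝ) ^ 2 := by fun_prop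
    have h0 : (1 - l) * (t + (0 : ℝ≥0) : ℝ) ^ 2 + l * (T - t + (0 : ℝ≥0) : ℝ) ^ 2 <
        l * (1 - l) * T ^ 2 + η ^ 2 := by
      have : (1 - l) * (t + (0 : ℝ≥0) : ℝ) ^ 2 + l * (T - t + (0 : ℝ≥0) : ℝ) ^ 2 =
          l * (1 - l) * T ^ 2 := by
        rw [hl_def, NNReal.coe_zero]; field_simp; ring
      rw [this]
      have := pow_pos hη' 2
      linarith
    have hev := hc.continuousAt.eventually_lt
      (continuousAt_const (y := l * (1 - l) * T ^ 2 + η ^ 2)) h0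
    obtain ⟨ε, h1, h2⟩ := ((hev.filter_mono nhdsWithin_le_nhds).and
      (self_mem_nhdsWithin (s := Ioi (0 : ℝ≥0)))).exists
    exact ⟨ε, h2, h1⟩
  have hε0 : (ε : ℝ≥0∞) ≠ 0 := by exact_mod_cast hε.ne'
  obtain ⟨π₁, hπ₁, hl₁⟩ := exists_coupling_l2_lt (μ := μ₀) (ν := μ₁)
    (ENNReal.lt_add_right (by rw [h₀₁]; simp) hε0)
  obtain ⟨π₂, hπ₂, hl₂⟩ := exists_coupling_l2_lt (μ := μ₁) (ν := μ₂)
    (ENNReal.lt_add_right (by rw [h₁₂]; simp) hε0)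
  rw [h₀₁] at hl₁
  rw [h₁₂] at hl₂
  obtain ⟨P, hP, e₁, e₂⟩ := exists_gluing hπ₁ hπ₂
  have hμ₀ : P.map (fun p => p.1.1) = μ₀ := by
    rw [← hπ₁.1, ← e₁, Measure.map_map measurable_fst measurable_fst]; rfl
  have hμ₂ : P.map (fun p => p.2) = μ₂ := by
    rw [← hπ₂.2, ← e₂, Measure.map_map measurable_snd (by fun_prop)]; rfl
  have hg := hX.measurable_geoPt x hl
  refine ⟨π₂, hπ₂, ?_⟩
  rw [← e₂, l2_map (by fun_prop) (by fun_prop)]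
  rw [← e₁, l2_map measurable_fst (by fun_prop)] at hl₁
  rw [← e₂, l2_map (by fun_prop) (by fun_prop)] at hl₂
  let E : (X × X) × X → ℝ := fun p => (1 - l) * dist p.1.2 p.1.1 ^ 2 + l * dist p.1.2 p.2 ^ 2 -
    l * (1 - l) * dist p.1.1 p.2 ^ 2
  have hE : Measurable E := by fun_prop
  have hE0 : ∀ p, 0 ≤ E p := fun p =>
    (sq_nonneg _).trans (hX.dist_geoPt_sq_le p.1.2 p.1.1 p.2 hl)
  have h1l : 0 ≤ 1 - l := by linarith [hl.2]
  have hEint : ∫⁻ p, ENNReal.ofReal (E p) ∂P ≤ (η : ℝ≥0∞) ^ 2 := by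
    have hA : ∫⁻ p, (ENNReal.ofReal (E p) + ENNReal.ofReal (l * (1 - l)) *
          edist p.1.1 p.2 ^ 2) ∂P =
        ∫⁻ p, (ENNReal.ofReal (1 - l) * edist p.1.1 p.1.2 ^ 2 +
          ENNReal.ofReal l * edist p.1.2 p.2 ^ 2) ∂P := by
      refine lintegral_congr fun p => ?_
      simp only [edist_dist, ← ENNReal.ofReal_pow dist_nonneg]
      rw [← ENNReal.ofReal_mul (mul_nonneg hl.1 h1l), ← ENNReal.ofReal_mul h1l,
        ← ENNReal.ofReal_mul hl.1,
        ← ENNReal.ofReal_add (hE0 p) (mul_nonneg (mul_nonneg hl.1 h1l) (sq_nonneg _)),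
        ← ENNReal.ofReal_add (mul_nonneg h1l (sq_nonneg _)) (mul_nonneg hl.1 (sq_nonneg _))]
      congr 1
      simp only [E, dist_comm p.1.2 p.1.1]
      ring
    rw [lintegral_add_left (by fun_prop), lintegral_add_left (by fun_prop),
      lintegral_const_mul _ (by fun_prop), lintegral_const_mul _ (by fun_prop),
      lintegral_const_mul _ (by fun_prop), ← l2_sq,
      ← l2_sq (f := fun p : (X × X) × X => edist p.1.1 p.1.2),
      ← l2_sq (f := fun p : (X × X) × X => edist p.1.2 p.2)] at hA
    have hTl : (T : ℝ≥0∞) ≤ l2 P (fun p => edist p.1.1 p.2) := by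
      rw [← h₀₂, ← hμ₀, ← hμ₂]
      exact wEDist_map_le P (by fun_prop) (by fun_prop)
    have hfin : ENNReal.ofReal (l * (1 - l)) * (T : ℝ≥0∞) ^ 2 ≠ ⊤ := by finiteness
    rw [← ENNReal.add_le_add_iff_right hfin]
    calc ∫⁻ p, ENNReal.ofReal (E p) ∂P + ENNReal.ofReal (l * (1 - l)) * (T : ℝ≥0∞) ^ 2
        ≤ ∫⁻ p, ENNReal.ofReal (E p) ∂P + ENNReal.ofReal (l * (1 - l)) *
          l2 P (fun p => edist p.1.1 p.2) ^ 2 := by gcongr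
      _ = _ := hA
      _ ≤ ENNReal.ofReal (1 - l) * (t + ε) ^ 2 +
          ENNReal.ofReal l * ((T - t : ℝ≥0) + ε) ^ 2 := by gcongr
      _ = ENNReal.ofReal ((1 - l) * (t + ε : ℝ) ^ 2 + l * (T - t + ε : ℝ) ^ 2) := by
          rw [ENNReal.ofReal_add (by positivity) (mul_nonneg hl.1 (sq_nonneg _)),
            ENNReal.ofReal_mul h1l, ENNReal.ofReal_mul hl.1, ENNReal.ofReal_pow (by positivity),
            ENNReal.ofReal_pow (by linarith [ε.coe_nonneg]), ← NNReal.coe_sub htT,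
            ← NNReal.coe_add, ← NNReal.coe_add, ENNReal.ofReal_coe_nnreal,
            ENNReal.ofReal_coe_nnreal, ENNReal.coe_add, ENNReal.coe_add]
      _ ≤ ENNReal.ofReal (l * (1 - l) * T ^ 2 + η ^ 2) := ENNReal.ofReal_le_ofReal hεη.le
      _ = (η : ℝ≥0∞) ^ 2 + ENNReal.ofReal (l * (1 - l)) * (T : ℝ≥0∞) ^ 2 := by
          rw [ENNReal.ofReal_add (mul_nonneg (mul_nonneg hl.1 h1l) (sq_nonneg _)) (sq_nonneg _),
            ENNReal.ofReal_mul (mul_nonneg hl.1 h1l), ENNReal.ofReal_pow hη'.le,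
            ENNReal.ofReal_pow hT'.le, ENNReal.ofReal_coe_nnreal, ENNReal.ofReal_coe_nnreal,
            add_comm]
  have hpt : ∀ p : (X × X) × X, edist p.1.2 (hX.geoPt x p.2 l) ≤
      ENNReal.ofReal √(E p) + edist x p.1.1 := fun p => by
    rw [edist_dist, edist_dist, ← ENNReal.ofReal_add (Real.sqrt_nonneg _) dist_nonneg]
    refine ENNReal.ofReal_le_ofReal ((hX.dist_geoPt_le_sqrt_add x p.1.2 p.1.1 p.2 hl).trans ?_)
    have := mul_le_of_le_one_left (dist_nonneg (x := x) (y := p.1.1))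
      (by linarith [hl.1] : 1 - l ≤ 1)
    have e : (1 - l) * dist p.1.2 p.1.1 ^ 2 + l * dist p.1.2 p.2 ^ 2 -
      l * (1 - l) * dist p.1.1 p.2 ^ 2 = E p := rfl
    rw [e]
    linarith
  calc l2 P (fun p => edist p.1.2 (hX.geoPt x p.2 l))
      ≤ l2 P (fun p => ENNReal.ofReal √(E p) + edist x p.1.1) := l2_mono hpt
    _ ≤ l2 P (fun p => ENNReal.ofReal √(E p)) + l2 P (fun p => edist x p.1.1) :=
        l2_add_le (by fun_prop) (by fun_prop)
    _ ≤ η + wEDist (Measure.dirac x) μ₀ := by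
        gcongr
        · refine l2_le_of_sq_le (le_trans (lintegral_congr fun p => ?_).le hEint)
          rw [← ENNReal.ofReal_pow (Real.sqrt_nonneg _), Real.sq_sqrt (hE0 p)]
        · rw [wEDist_dirac, ← hμ₀, l2_map (by fun_prop) (by fun_prop)]
    _ = _ := add_comm _ _

end WassersteinRays

/-- Unit speed rays of probability measures, for the extended Wasserstein distance. -/
structure IsWRay {X : Type*} [MetricSpace X] [MeasurableSpace X] (f : ℝ≥0 → Measure X) :
    Prop where
  prob : ∀ t, IsProbabilityMeasure (f t)
  wEDist_eq : ∀ s t, wEDist (f s) (f t) = edist s t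

lemma NNReal.edist_eq_sub {s t : ℝ≥0} (h : s ≤ t) : edist s t = ((t - s : ℝ≥0) : ℝ≥0∞) := by
  rw [edist_dist, NNReal.dist_eq, abs_sub_comm, abs_of_nonneg (sub_nonneg.2 (by exact_mod_cast h)),
    ← NNReal.coe_sub h, ENNReal.ofReal_coe_nnreal]

lemma NNReal.edist_zero_left (t : ℝ≥0) : edist 0 t = (t : ℝ≥0∞) := by
  rw [NNReal.edist_eq_sub zero_le, tsub_zero]

lemma ENNReal.eq_zero_of_forall_le_div {a : ℝ≥0∞} {s : ℝ≥0} {C : ℝ≥0∞} (hC : C ≠ ⊤)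
    (h : ∀ t : ℝ≥0, s ≤ t → 0 < t → a ≤ ENNReal.ofReal (s / t) * C) : a = 0 := by
  have hlim : Tendsto (fun t : ℝ≥0 => ENNReal.ofReal (s / t) * C) atTop
      (𝓝 (ENNReal.ofReal 0 * C)) := by
    refine ENNReal.Tendsto.mul_const (ENNReal.tendsto_ofReal ?_) (Or.inr hC)
    exact tendsto_const_nhds.div_atTop (NNReal.tendsto_coe_atTop.2 tendsto_id)
  rw [ENNReal.ofReal_zero, zero_mul] at hlim
  refine nonpos_iff_eq_zero.1 (ge_of_tendsto hlim ?_)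
  filter_upwards [eventually_ge_atTop s, eventually_gt_atTop 0] with t h1 h2
  exact h t h1 h2

section RaysFromDirac

variable {X : Type*} [MetricSpace X] [MeasurableSpace X] [BorelSpace X]
  [SecondCountableTopology X]

lemma wEDist_map_geoPt_le (hX : IsHadamard X) (x : X) {s t : ℝ≥0} (hst : s ≤ t)
    {μ ν : Measure X} (h : wEDist μ ν ≠ ⊤) :
    wEDist (μ.map fun z => hX.geoPt x z (s / t)) (ν.map fun z => hX.geoPt x z (s / t)) ≤
      ENNReal.ofReal (s / t) * wEDist μ ν := by
  have hl := div_mem_unit hst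
  refine wEDist_map_map_le (hX.measurable_geoPt x hl) (fun y z => ?_) _ _ h (by simp)
  rw [edist_dist, edist_dist, ← ENNReal.ofReal_mul hl.1]
  exact ENNReal.ofReal_le_ofReal (hX.dist_geoPt_le_of_left x y z hl)

variable [CompleteSpace X] {f f' : ℝ≥0 → Measure X} {x : X}

lemma IsWRay.eq_map_geoPt (hX : IsHadamard X) (hf : IsWRay f) (h0 : f 0 = Measure.dirac x)
    {s t : ℝ≥0} (hst : s ≤ t) (ht : 0 < t) :
    f s = (f t).map (fun z => hX.geoPt x z (s / t)) := by
  have := hf.prob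
  have hg := hX.measurable_geoPt x (div_mem_unit hst)
  have : IsProbabilityMeasure ((f t).map (fun z => hX.geoPt x z (s / t))) :=
    Measure.isProbabilityMeasure_map hg.aemeasurable
  refine eq_of_wEDist_eq_zero (nonpos_iff_eq_zero.1 ?_)
  refine ENNReal.le_of_forall_pos_le_add fun η hη _ => ?_
  obtain ⟨π, hπ, hl⟩ := exists_coupling_contraction hX x ht hst (μ₀ := f 0) (μ₁ := f s) (μ₂ := f t)
    (by rw [hf.wEDist_eq, NNReal.edist_zero_left])
    (by rw [hf.wEDist_eq, NNReal.edist_eq_sub hst])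
    (by rw [hf.wEDist_eq, NNReal.edist_zero_left]) hη
  rw [h0, wEDist_self] at hl
  refine le_trans ?_ hl
  have h := wEDist_map_le π (f := Prod.fst) (g := fun p => hX.geoPt x p.2 (s / t))
    measurable_fst (hg.comp measurable_snd)
  have e : π.map (fun p => hX.geoPt x p.2 (s / t)) =
      (f t).map (fun z => hX.geoPt x z (s / t)) := by
    rw [← hπ.2, Measure.map_map hg measurable_snd]; rfl
  rwa [hπ.1, e] at h

lemma IsWRay.eq_of_bounded (hX : IsHadamard X) (hf : IsWRay f) (hf' : IsWRay f')
    (h0 : f 0 = Measure.dirac x) (h0' : f' 0 = Measure.dirac x) {C : ℝ≥0∞} (hC : C ≠ ⊤)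
    (h : ∀ t, wEDist (f t) (f' t) ≤ C) : f = f' := by
  funext s
  have := hf.prob
  have := hf'.prob
  refine eq_of_wEDist_eq_zero (ENNReal.eq_zero_of_forall_le_div hC (s := s) fun t hst ht => ?_)
  rw [hf.eq_map_geoPt hX h0 hst ht, hf'.eq_map_geoPt hX h0' hst ht]
  exact (wEDist_map_geoPt_le hX x hst (ne_top_of_le_ne_top hC (h t))).trans (by gcongr; exact h t)

end RaysFromDirac

/-! ## Displacement interpolations -/

section Displacement

variable {X : Type*} [MetricSpace X] [MeasurableSpace X] {x : X} {m : Measure (RaySpace X)}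

lemma map_rayEval_zero [IsProbabilityMeasure m] (hm0 : ∀ᵐ γ ∂m, γ.1 0 = x) :
    m.map (rayEval 0) = Measure.dirac x := by
  rw [Measure.map_congr (f := rayEval 0) (g := fun _ => x) hm0, Measure.map_const,
    measure_univ, one_smul]

variable [BorelSpace X]

lemma ae_ray_zero_of_map (h : m.map (rayEval 0) = Measure.dirac x) : ∀ᵐ γ ∂m, γ.1 0 = x := by
  refine ae_of_ae_map (p := fun y => y = x) (measurable_rayEval 0).aemeasurable ?_
  rw [h]
  exact (ae_dirac_iff (measurableSet_singleton x)).2 rfl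

/-- Displacement interpolations from a point are determined by their time marginals. -/
lemma eq_of_map_rayEval_eq (hX : IsHadamard X) {m' : Measure (RaySpace X)}
    [IsProbabilityMeasure m] [IsProbabilityMeasure m'] (hm0 : ∀ᵐ γ ∂m, γ.1 0 = x)
    (hm0' : ∀ᵐ γ ∂m', γ.1 0 = x) (h : ∀ t, m.map (rayEval t) = m'.map (rayEval t)) :
    m = m' := by
  have hval : Measurable (Subtype.val : RaySpace X → ℝ≥0 → X) := measurable_subtype_coe
  have key : ∀ (m : Measure (RaySpace X)) (_ : ∀ᵐ γ ∂m, γ.1 0 = x) (I : Finset ℝ≥0),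
      (m.map Subtype.val).map I.restrict = (m.map (rayEval (I.sup id + 1))).map
        (fun y (i : I) => hX.geoPt x y ((i : ℝ≥0) / (I.sup id + 1 : ℝ≥0))) := by
    intro m hm0 I
    have hle : ∀ i : I, (i : ℝ≥0) ≤ I.sup id + 1 := fun i =>
      (Finset.le_sup (f := id) i.2).trans (le_add_of_nonneg_right zero_le)
    rw [Measure.map_map (Finset.measurable_restrict I) hval, Measure.map_map
      (measurable_pi_lambda _ fun i => hX.measurable_geoPt x (div_mem_unit (hle i)))
      (measurable_rayEval _)]
    refine Measure.map_congr (hm0.mono fun γ hγ => ?_)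
    obtain ⟨v, _, hv⟩ := γ.2
    funext i
    have := ray_eq_geoPt hX hv (by positivity) (hle i)
    rw [hγ] at this
    exact this
  have hpi : m.map Subtype.val = m'.map Subtype.val := by
    have := Measure.isProbabilityMeasure_map (μ := m) hval.aemeasurable
    have := Measure.isProbabilityMeasure_map (μ := m') hval.aemeasurable
    refine IsProjectiveLimit.unique (P := fun I => (m.map Subtype.val).map I.restrict)
      (fun I => rfl) (fun I => ?_)
    exact (key m' hm0' I).trans ((h _ ▸ key m hm0 I).symm)
  ext s hs
  obtain ⟨u, hu, rfl⟩ := hs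
  rw [← Measure.map_apply hval hu, ← Measure.map_apply hval hu, hpi]

variable [SecondCountableTopology X]

lemma wEDist_dirac_map_rayEval [IsProbabilityMeasure m] (hm0 : ∀ᵐ γ ∂m, γ.1 0 = x)
    (hs : Measurable fun γ : RaySpace X => (raySpeed γ : ℝ≥0∞)) (t : ℝ≥0) :
    wEDist (Measure.dirac x) (m.map (rayEval t)) = t * l2 m (fun γ => (raySpeed γ : ℝ≥0∞)) := by
  have : IsProbabilityMeasure (m.map (rayEval t)) :=
    Measure.isProbabilityMeasure_map (measurable_rayEval t).aemeasurable
  rw [wEDist_dirac, l2_map (measurable_rayEval t) (by fun_prop), ← l2_const_mul _ hs]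
  refine l2_congr_ae (hm0.mono fun γ hγ => ?_)
  rw [← hγ]
  exact edist_ray_zero γ t

lemma isWRay_map_rayEval [CompleteSpace X] [IsProbabilityMeasure m] (hm0 : ∀ᵐ γ ∂m, γ.1 0 = x)
    (hs : Measurable fun γ : RaySpace X => (raySpeed γ : ℝ≥0∞))
    (hm1 : l2 m (fun γ => (raySpeed γ : ℝ≥0∞)) = 1) : IsWRay fun t => m.map (rayEval t) := by
  have hp : ∀ t, IsProbabilityMeasure (m.map (rayEval t)) := fun t =>
    Measure.isProbabilityMeasure_map (measurable_rayEval t).aemeasurable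
  refine ⟨hp, ?_⟩
  have hle : ∀ s t, s ≤ t → wEDist (m.map (rayEval s)) (m.map (rayEval t)) = edist s t := by
    intro s t hst
    apply le_antisymm
    · calc _ ≤ l2 m (fun γ => edist (rayEval s γ) (rayEval t γ)) :=
            wEDist_map_le m (measurable_rayEval s) (measurable_rayEval t)
        _ = l2 m (fun γ => edist s t * (raySpeed γ : ℝ≥0∞)) := by
            congr 1
            funext γ
            rw [edist_dist, edist_dist, rayEval, rayEval, dist_ray, mul_comm,
              ENNReal.ofReal_mul dist_nonneg, ENNReal.ofReal_coe_nnreal]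
        _ = edist s t := by rw [l2_const_mul _ hs, hm1, mul_one]
    · have h := wEDist_triangle (Measure.dirac x) (m.map (rayEval s)) (m.map (rayEval t))
      rw [wEDist_dirac_map_rayEval hm0 hs, wEDist_dirac_map_rayEval hm0 hs, hm1, mul_one,
        mul_one] at h
      rw [NNReal.edist_eq_sub hst, ENNReal.coe_sub]
      exact tsub_le_iff_left.2 h
  intro s t
  rcases le_total s t with h | h
  · exact hle s t h
  · rw [wEDist_comm, edist_comm]; exact hle t s h

end Displacement

/-! ## The displacement interpolation asymptotic to a given ray -/

section AsymptoticDisplacement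

variable {X : Type*} [MetricSpace X]

lemma rayDefect_nonneg (hX : IsHadamard X) (x : X) (z : ℕ → X) (n : ℕ) :
    0 ≤ rayDefect hX x z n :=
  div_nonneg dist_nonneg (by positivity)

lemma summable_rayDefect {hX : IsHadamard X} {x : X} {z : ℕ → X}
    (h : ∑' n, ENNReal.ofReal (rayDefect hX x z n) ≠ ⊤) : Summable (rayDefect hX x z) := by
  simpa only [ENNReal.toReal_ofReal (rayDefect_nonneg hX x z _)] using ENNReal.summable_toReal h

open Classical in
/-- The limit of the approximating rays of a sequence of points, where it exists. -/
def limitRay (hX : IsHadamard X) (x : X) (z : ℕ → X) : RaySpace X :=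
  if h : ∑' n, ENNReal.ofReal (rayDefect hX x z n) ≠ ⊤ then
    (exists_limit_ray hX x z (summable_rayDefect h)).choose
  else constRay x

lemma limitRay_zero (hX : IsHadamard X) (x : X) (z : ℕ → X) : (limitRay hX x z).1 0 = x := by
  rw [limitRay]
  split_ifs with h
  · exact (exists_limit_ray hX x z (summable_rayDefect h)).choose_spec.1
  · rfl

lemma tendsto_approxRay_limitRay (hX : IsHadamard X) (x : X) {z : ℕ → X}
    (h : ∑' n, ENNReal.ofReal (rayDefect hX x z n) ≠ ⊤) (t : ℝ≥0) :
    Tendsto (fun n => approxRay hX x z n t) atTop (𝓝 ((limitRay hX x z).1 t)) := by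
  rw [limitRay, dif_pos h]
  exact (exists_limit_ray hX x z (summable_rayDefect h)).choose_spec.2.1 t

lemma edist_approxRay_limitRay_le (hX : IsHadamard X) (x : X) {z : ℕ → X}
    (h : ∑' n, ENNReal.ofReal (rayDefect hX x z n) ≠ ⊤) {n : ℕ} {t : ℝ≥0} (ht : t ≤ 2 ^ n) :
    edist (approxRay hX x z n t) ((limitRay hX x z).1 t) ≤
      ∑' k, (t : ℝ≥0∞) * ENNReal.ofReal (rayDefect hX x z (n + k)) := by
  have hd := rayDefect_nonneg hX x z
  have hs := summable_rayDefect h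
  have hs' : Summable fun k => rayDefect hX x z (n + k) := by
    simpa only [add_comm] using (summable_nat_add_iff n).2 hs
  rw [ENNReal.tsum_mul_left, ← ENNReal.ofReal_tsum_of_nonneg (fun k => hd _) hs',
    ← ENNReal.ofReal_coe_nnreal, ← ENNReal.ofReal_mul t.coe_nonneg, edist_dist, limitRay,
    dif_pos h]
  exact ENNReal.ofReal_le_ofReal ((exists_limit_ray hX x z hs).choose_spec.2.2 n t ht)

variable [MeasurableSpace X] [BorelSpace X]

lemma measurable_approxRay (hX : IsHadamard X) (x : X) (n : ℕ) (t : ℝ≥0) :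
    Measurable fun z : ℕ → X => approxRay hX x z n t :=
  (hX.measurable_geoPt x (min_one_div_mem n t)).comp (measurable_pi_apply n)

variable [SecondCountableTopology X]

lemma measurable_ofReal_rayDefect (hX : IsHadamard X) (x : X) (n : ℕ) :
    Measurable fun z : ℕ → X => ENNReal.ofReal (rayDefect hX x z n) := by
  have hg := hX.measurable_geoPt x (t := 1 / 2) ⟨by norm_num, by norm_num⟩
  unfold rayDefect
  fun_prop

lemma measurable_limitRay (hX : IsHadamard X) (x : X) : Measurable (limitRay hX x) := by
  classical
  suffices h : Measurable fun z => (limitRay hX x z).1 from h.subtype_mk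
  refine measurable_pi_lambda _ fun t => ?_
  have hS : MeasurableSet {z | ∑' n, ENNReal.ofReal (rayDefect hX x z n) ≠ ⊤} :=
    ((Measurable.tsum fun n => measurable_ofReal_rayDefect hX x n)
      (measurableSet_singleton ⊤)).compl
  refine measurable_of_tendsto_metrizable (f := fun n z =>
    if ∑' n, ENNReal.ofReal (rayDefect hX x z n) ≠ ⊤ then approxRay hX x z n t else x)
    (fun n => Measurable.ite hS (measurable_approxRay hX x n t) measurable_const)
    (tendsto_pi_nhds.2 fun z => ?_)
  by_cases h : ∑' n, ENNReal.ofReal (rayDefect hX x z n) ≠ ⊤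
  · simpa only [if_pos h] using tendsto_approxRay_limitRay hX x h t
  · simp only [if_neg h, limitRay, dif_neg h]
    exact tendsto_const_nhds

variable [CompleteSpace X]

/-- Every unit speed ray of measures stays at bounded distance of a displacement interpolation
starting at `x`. -/
lemma exists_displacement_bounded (hX : IsHadamard X) (x : X) {g : ℝ≥0 → Measure X}
    (hg : IsWRay g) (hfin : wEDist (Measure.dirac x) (g 0) ≠ ⊤) :
    ∃ m : Measure (RaySpace X), IsProbabilityMeasure m ∧ (∀ᵐ γ ∂m, γ.1 0 = x) ∧
      ∃ C : ℝ≥0∞, C ≠ ⊤ ∧ ∀ t, wEDist (m.map (rayEval t)) (g t) ≤ C := by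
  have : Nonempty X := ⟨x⟩
  have hprob := hg.prob
  set C : ℝ≥0∞ := wEDist (Measure.dirac x) (g 0) + (1 : ℝ≥0) with hC
  have hCt : C ≠ ⊤ := by finiteness
  have hcpl : ∀ {s t : ℝ≥0}, s ≤ t → 0 < t → ∃ π, IsCoupling π (g s) (g t) ∧
      l2 π (fun p => edist p.1 (hX.geoPt x p.2 (s / t))) ≤ C := fun {s t} hst ht =>
    exists_coupling_contraction hX x ht hst
      (by rw [hg.wEDist_eq, NNReal.edist_zero_left])
      (by rw [hg.wEDist_eq, NNReal.edist_eq_sub hst])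
      (by rw [hg.wEDist_eq, NNReal.edist_zero_left]) one_pos
  have hpow : ∀ n : ℕ, (2 : ℝ≥0) ^ n ≤ 2 ^ (n + 1) := fun n =>
    pow_le_pow_right₀ one_le_two n.le_succ
  have hhalf : ∀ n : ℕ, (((2 : ℝ≥0) ^ n : ℝ≥0) : ℝ) / ((2 : ℝ≥0) ^ (n + 1) : ℝ≥0) = 1 / 2 :=
    fun n => by push_cast; rw [pow_succ]; field_simp
  choose π hπ hπC using fun n => hcpl (hpow n) (by positivity)
  simp only [hhalf] at hπC
  obtain ⟨P, hP, hPπ⟩ := exists_markov_chain (fun n => g (2 ^ n)) π hπ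
  have hgeo := hX.measurable_geoPt x (t := 1 / 2) ⟨by norm_num, by norm_num⟩
  have hPn : ∀ n, P.map (fun z => z n) = g (2 ^ n) := fun n => by
    rw [← (hπ n).1, ← hPπ n, Measure.map_map measurable_fst (by fun_prop)]; rfl
  have hD : ∀ n, l2 P (fun z => ENNReal.ofReal (rayDefect hX x z n)) ≤ 2⁻¹ ^ n * C := fun n => by
    have h := hπC n
    rw [← hPπ n, l2_map (by fun_prop) (by fun_prop)] at h
    calc l2 P (fun z => ENNReal.ofReal (rayDefect hX x z n))
        = l2 P (fun z => 2⁻¹ ^ n * edist (z n) (hX.geoPt x (z (n + 1)) (1 / 2))) := by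
          congr 1
          funext z
          rw [rayDefect, ENNReal.ofReal_div_of_pos (by positivity), edist_dist,
            ENNReal.ofReal_pow (by norm_num), ENNReal.ofReal_ofNat, ENNReal.div_eq_inv_mul,
            ENNReal.inv_pow]
      _ = 2⁻¹ ^ n * l2 P (fun z => edist (z n) (hX.geoPt x (z (n + 1)) (1 / 2))) :=
          l2_const_mul _ (by fun_prop)
      _ ≤ 2⁻¹ ^ n * C := by gcongr
  have hgood : ∀ᵐ z ∂P, ∑' n, ENNReal.ofReal (rayDefect hX x z n) ≠ ⊤ := by
    have hm : Measurable fun z : ℕ → X => ∑' n, ENNReal.ofReal (rayDefect hX x z n) :=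
      Measurable.tsum fun n => measurable_ofReal_rayDefect hX x n
    have hle : l2 P (fun z => ∑' n, ENNReal.ofReal (rayDefect hX x z n)) ≤ 2 * C := by
      refine (l2_tsum_le fun n => measurable_ofReal_rayDefect hX x n).trans ?_
      refine (ENNReal.tsum_le_tsum hD).trans ?_
      rw [ENNReal.tsum_mul_right, ENNReal.tsum_geometric_two]
    have h_int : ∫⁻ z, (∑' n, ENNReal.ofReal (rayDefect hX x z n)) ^ 2 ∂P ≠ ⊤ := by
      rw [← l2_sq]
      exact ENNReal.pow_ne_top (ne_top_of_le_ne_top (by finiteness) hle)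
    filter_upwards [ae_lt_top (hm.pow_const 2) h_int] with z hz
    intro h
    simp [h] at hz
  have hL := measurable_limitRay hX x
  refine ⟨P.map (limitRay hX x), Measure.isProbabilityMeasure_map hL.aemeasurable, ?_,
    2 * C + C, by finiteness, fun t => ?_⟩
  · refine (ae_map_iff hL.aemeasurable (measurable_rayEval 0 (measurableSet_singleton x))).2 ?_
    exact ae_of_all _ fun z => limitRay_zero hX x z
  · obtain ⟨n, hn⟩ := exists_le_two_pow t
    have hr := measurable_rayEval (X := X) t
    have ha := measurable_approxRay hX x n t
    have hgn := hX.measurable_geoPt x (div_mem_unit hn)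
    have hpa : IsProbabilityMeasure (P.map fun z => approxRay hX x z n t) :=
      Measure.isProbabilityMeasure_map ha.aemeasurable
    have hpl : IsProbabilityMeasure ((P.map (limitRay hX x)).map (rayEval t)) := by
      rw [Measure.map_map hr hL]
      exact Measure.isProbabilityMeasure_map (hr.comp hL).aemeasurable
    refine (wEDist_triangle _ (P.map fun z => approxRay hX x z n t) _).trans (add_le_add ?_ ?_)
    · rw [wEDist_comm, Measure.map_map hr hL]
      refine (wEDist_map_le P ha (hr.comp hL)).trans ?_
      calc l2 P (fun z => edist (approxRay hX x z n t) ((limitRay hX x z).1 t))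
          ≤ l2 P (fun z => ∑' k, (t : ℝ≥0∞) * ENNReal.ofReal (rayDefect hX x z (n + k))) :=
            l2_mono_ae (hgood.mono fun z hz => edist_approxRay_limitRay_le hX x hz hn)
        _ ≤ ∑' k, l2 P (fun z => (t : ℝ≥0∞) * ENNReal.ofReal (rayDefect hX x z (n + k))) :=
            l2_tsum_le fun k => (measurable_ofReal_rayDefect hX x (n + k)).const_mul _
        _ ≤ ∑' k : ℕ, (2⁻¹ ^ k * C) := by
            refine ENNReal.tsum_le_tsum fun k => ?_
            rw [l2_const_mul _ (measurable_ofReal_rayDefect hX x (n + k))]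
            have ht : (t : ℝ≥0∞) ≤ 2 ^ n := by exact_mod_cast hn
            calc (t : ℝ≥0∞) * l2 P (fun z => ENNReal.ofReal (rayDefect hX x z (n + k)))
                ≤ 2 ^ n * (2⁻¹ ^ (n + k) * C) := by gcongr; exact hD _
              _ = (2 * 2⁻¹) ^ n * (2⁻¹ ^ k * C) := by rw [pow_add, mul_pow]; ring
              _ = 2⁻¹ ^ k * C := by
                  rw [ENNReal.mul_inv_cancel (by simp) (by simp), one_pow, one_mul]
        _ = 2 * C := by rw [ENNReal.tsum_mul_right, ENNReal.tsum_geometric_two]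
    · obtain ⟨ρ, hρ, hρC⟩ := hcpl hn (by positivity)
      refine le_trans ?_ hρC
      have h := wEDist_map_le ρ (f := fun p => hX.geoPt x p.2 (t / (2 ^ n : ℝ≥0))) (g := Prod.fst)
        (hgn.comp measurable_snd) measurable_fst
      have e : P.map (fun z => approxRay hX x z n t) =
          ρ.map (fun p => hX.geoPt x p.2 (t / (2 ^ n : ℝ≥0))) := by
        have e1 : ρ.map (fun p => hX.geoPt x p.2 (t / (2 ^ n : ℝ≥0))) =
            (ρ.map Prod.snd).map (fun y => hX.geoPt x y (t / (2 ^ n : ℝ≥0))) := by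
          rw [Measure.map_map hgn measurable_snd]; rfl
        have e2 : (fun z => approxRay hX x z n t) =
            (fun y => hX.geoPt x y (t / (2 ^ n : ℝ≥0))) ∘ fun z : ℕ → X => z n := by
          funext z
          simp only [approxRay, min_one_div_eq hn, Function.comp_apply, NNReal.coe_pow,
            NNReal.coe_ofNat]
        rw [e1, hρ.2, ← hPn n, Measure.map_map hgn (measurable_pi_apply n), e2]
      rw [e, ← hρ.1]
      refine h.trans (l2_mono fun p => ?_)
      rw [edist_comm]

end AsymptoticDisplacement

section Correspondence

variable {X : Type*} [MetricSpace X] [MeasurableSpace X] [BorelSpace X]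

lemma measurable_raySpeed (hX : IsHadamard X) :
    Measurable fun γ : RaySpace X => (raySpeed γ : ℝ≥0∞) := by
  have := opensMeasurableSpace_raySpace hX
  exact continuous_raySpeed.measurable.coe_nnreal_ennreal

lemma map_coneRay_map_rayEnd (hX : IsHadamard X) (x : X) (ν : Measure (Cone (Boundary X))) :
    (ν.map (coneRay hX x)).map rayEnd = ν := by
  rw [Measure.map_map (measurable_rayEnd hX) (measurable_coneRay hX x)]
  convert Measure.map_id using 2
  exact funext fun c => rayEnd_coneRay hX x c

lemma map_rayEnd_map_coneRay (hX : IsHadamard X) {x : X} {m : Measure (RaySpace X)}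
    (hm0 : ∀ᵐ γ ∂m, γ.1 0 = x) : (m.map rayEnd).map (coneRay hX x) = m := by
  rw [Measure.map_map (measurable_coneRay hX x) (measurable_rayEnd hX)]
  refine (Measure.map_congr (g := id) (hm0.mono fun γ hγ => ?_)).trans Measure.map_id
  exact coneRay_rayEnd hX x hγ

lemma l2_raySpeed_map_coneRay (hX : IsHadamard X) (x : X) (ν : Measure (Cone (Boundary X))) :
    l2 (ν.map (coneRay hX x)) (fun γ => (raySpeed γ : ℝ≥0∞)) =
      l2 ν (fun c => (coneSpeed c : ℝ≥0∞)) := by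
  rw [l2_map (measurable_coneRay hX x) (measurable_raySpeed hX)]
  simp only [raySpeed_coneRay]

variable [CompleteSpace X] [SecondCountableTopology X]

lemma isWRay_of_Wdist {f : ℝ≥0 → W2Space X} (hf : ∀ s t : ℝ≥0, Wdist (f s) (f t) = dist s t) :
    IsWRay fun t => (f t).1 :=
  ⟨fun t => (f t).2.1, fun s t => by rw [← ofReal_Wdist, hf, edist_dist]⟩

/-- A unit speed ray of measures issued from a Dirac mass, as a ray of the Wasserstein space. -/
def IsWRay.toW2 {f : ℝ≥0 → Measure X} {x : X} (hf : IsWRay f) (h0 : f 0 = Measure.dirac x) :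
    {f : ℝ≥0 → W2Space X // (f 0).1 = Measure.dirac x ∧
      ∀ s t : ℝ≥0, Wdist (f s) (f t) = dist s t} :=
  ⟨fun t => ⟨f t, hf.prob t, x, by
      have := hf.prob t
      have h := hf.wEDist_eq 0 t
      rw [h0, wEDist_dirac, NNReal.edist_zero_left] at h
      simp only [← edist_dist]
      rw [← l2_sq, h]
      finiteness⟩, h0, fun s t => by
    rw [Wdist_eq_toReal, hf.wEDist_eq, edist_dist, ENNReal.toReal_ofReal dist_nonneg]⟩

lemma l2_raySpeed_eq_one (hX : IsHadamard X) {x : X} {g : ℝ≥0 → Measure X} (hg : IsWRay g)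
    (hfin : wEDist (Measure.dirac x) (g 0) ≠ ⊤) {m : Measure (RaySpace X)}
    [IsProbabilityMeasure m] (hm0 : ∀ᵐ γ ∂m, γ.1 0 = x) {C : ℝ≥0∞} (hC : C ≠ ⊤)
    (h : ∀ t, wEDist (m.map (rayEval t)) (g t) ≤ C) :
    l2 m (fun γ => (raySpeed γ : ℝ≥0∞)) = 1 := by
  have hprob := hg.prob
  have hmprob : ∀ t, IsProbabilityMeasure (m.map (rayEval t)) := fun t =>
    Measure.isProbabilityMeasure_map (measurable_rayEval t).aemeasurable
  have hs := measurable_raySpeed hX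
  set V := l2 m (fun γ => (raySpeed γ : ℝ≥0∞)) with hV
  set K := wEDist (Measure.dirac x) (g 0) + C with hK
  have hKt : K ≠ ⊤ := by finiteness
  have hle : ∀ t : ℝ≥0, t * V ≤ t + K := fun t => by
    calc t * V = wEDist (Measure.dirac x) (m.map (rayEval t)) :=
          (wEDist_dirac_map_rayEval hm0 hs t).symm
      _ ≤ wEDist (Measure.dirac x) (g t) + wEDist (g t) (m.map (rayEval t)) :=
          wEDist_triangle _ _ _
      _ ≤ (wEDist (Measure.dirac x) (g 0) + wEDist (g 0) (g t)) + C := by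
          gcongr
          · exact wEDist_triangle _ _ _
          · rw [wEDist_comm]; exact h t
      _ = t + K := by
          rw [hg.wEDist_eq, NNReal.edist_zero_left, hK]; ring
  have hge : ∀ t : ℝ≥0, t ≤ t * V + K := fun t => by
    calc (t : ℝ≥0∞) = wEDist (g 0) (g t) := by rw [hg.wEDist_eq, NNReal.edist_zero_left]
      _ ≤ wEDist (g 0) (Measure.dirac x) + wEDist (Measure.dirac x) (g t) :=
          wEDist_triangle _ _ _
      _ ≤ wEDist (g 0) (Measure.dirac x) +
          (wEDist (Measure.dirac x) (m.map (rayEval t)) + C) := by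
          gcongr
          exact (wEDist_triangle _ (m.map (rayEval t)) _).trans (by gcongr; exact h t)
      _ = t * V + K := by
          rw [wEDist_comm, wEDist_dirac_map_rayEval hm0 hs, hK]; ring
  have hVt : V ≠ ⊤ := by
    have h1 := hle 1
    rw [ENNReal.coe_one, one_mul] at h1
    exact ne_top_of_le_ne_top (by finiteness) h1
  clear_value V K
  lift V to ℝ≥0 using hVt
  lift K to ℝ≥0 using hKt
  have hle' : ∀ t : ℝ≥0, t * V ≤ t + K := fun t => by exact_mod_cast hle t
  have hge' : ∀ t : ℝ≥0, t ≤ t * V + K := fun t => by exact_mod_cast hge t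
  have hlim : Tendsto (fun t : ℝ≥0 => (K : ℝ) / t) atTop (𝓝 0) :=
    tendsto_const_nhds.div_atTop (NNReal.tendsto_coe_atTop.2 tendsto_id)
  have h0 : |(V : ℝ) - 1| ≤ 0 := by
    refine ge_of_tendsto hlim ?_
    filter_upwards [eventually_gt_atTop 0] with t ht
    have ht' : (0 : ℝ) < t := by exact_mod_cast ht
    have h1 : (t : ℝ) * V ≤ t + K := by exact_mod_cast hle' t
    have h2 : (t : ℝ) ≤ t * V + K := by exact_mod_cast hge' t
    rw [le_div_iff₀ ht', ← abs_of_pos ht', ← abs_mul, abs_le]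
    constructor <;> nlinarith
  have h1 : (V : ℝ) = 1 := by linarith [abs_eq_zero.1 (le_antisymm h0 (abs_nonneg _))]
  exact_mod_cast h1

end Correspondence

/-- **Statement 13.** The set of unit-speed geodesic rays of `W₂(X)` starting at a Dirac
mass `δ_x` is in one-to-one correspondence (through asymptotic measures of displacement
interpolations) with the set `P₁(c∂X)` of probability measures `ν` on the cone over the
boundary with `∫ v² dν = 1`; and every asymptote class of unit rays of `W₂(X)` contains a
unique unit ray starting at `δ_x`. -/
theorem rays_from_dirac_correspondence
    (X : Type*) [MetricSpace X] [MeasurableSpace X] [BorelSpace X]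
    (hX : IsHadamard X) (x : X) :
    (∃ F : {f : ℝ≥0 → W2Space X // (f 0).1 = Measure.dirac x ∧
              ∀ s t : ℝ≥0, Wdist (f s) (f t) = dist s t} ≃ P1ConeM X,
      ∀ R (m : Measure (RaySpace X)), IsProbabilityMeasure m →
        (∀ t : ℝ≥0, m.map (rayEval t) = (R.1 t).1) → (F R).1 = m.map rayEnd) ∧
    (∀ g : ℝ≥0 → W2Space X, (∀ s t : ℝ≥0, Wdist (g s) (g t) = dist s t) →
      ∃! f : {f : ℝ≥0 → W2Space X // (f 0).1 = Measure.dirac x ∧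
                ∀ s t : ℝ≥0, Wdist (f s) (f t) = dist s t},
        AsymptoticMaps Wdist f.1 g) := by
  have := hX.complete
  have := hX.separable
  have : SecondCountableTopology X := UniformSpace.secondCountable_of_separable X
  have hs := measurable_raySpeed hX
  have hfin : ∀ {g : ℝ≥0 → W2Space X}, wEDist (Measure.dirac x) (g 0).1 ≠ ⊤ := fun {g} =>
    (wEDist_lt_top ⟨Measure.dirac x, inferInstance, x, by
      simp only [← edist_dist]
      rw [lintegral_dirac' _ (by fun_prop), edist_self]
      simp⟩ (g 0)).ne
  have hprob : ∀ ν : P1ConeM X, IsProbabilityMeasure (ν.1.map (coneRay hX x)) := fun ν =>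
    have := ν.2.1
    Measure.isProbabilityMeasure_map (measurable_coneRay hX x).aemeasurable
  have hzero : ∀ ν : P1ConeM X, ∀ᵐ γ ∂(ν.1.map (coneRay hX x)), γ.1 0 = x := fun ν =>
    (ae_map_iff (measurable_coneRay hX x).aemeasurable
      (measurable_rayEval 0 (measurableSet_singleton x))).2 (ae_of_all _ (coneRay_zero hX x))
  have hone : ∀ ν : P1ConeM X,
      l2 (ν.1.map (coneRay hX x)) (fun γ => (raySpeed γ : ℝ≥0∞)) = 1 := fun ν => by
    rw [l2_raySpeed_map_coneRay, l2, ν.2.2, ENNReal.one_rpow]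
  let G : P1ConeM X → {f : ℝ≥0 → W2Space X // (f 0).1 = Measure.dirac x ∧
      ∀ s t : ℝ≥0, Wdist (f s) (f t) = dist s t} := fun ν =>
    (isWRay_map_rayEval (hzero ν) hs (hone ν)).toW2 (map_rayEval_zero (hzero ν))
  have hG : ∀ R (m : Measure (RaySpace X)), IsProbabilityMeasure m →
      (∀ t : ℝ≥0, m.map (rayEval t) = (R.1 t).1) → ∃ ν, G ν = R ∧ ν.1 = m.map rayEnd := by
    intro R m hm hR
    have hm0 : ∀ᵐ γ ∂m, γ.1 0 = x := ae_ray_zero_of_map ((hR 0).trans R.2.1)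
    have hcone := map_rayEnd_map_coneRay hX hm0
    have hspeed : l2 m (fun γ => (raySpeed γ : ℝ≥0∞)) = 1 := by
      have h := wEDist_dirac_map_rayEval hm0 hs 1
      have hd := (isWRay_of_Wdist R.2.2).wEDist_eq 0 1
      rw [R.2.1, NNReal.edist_zero_left] at hd
      rw [hR, hd, ENNReal.coe_one, one_mul] at h
      exact h.symm
    refine ⟨⟨m.map rayEnd, Measure.isProbabilityMeasure_map (measurable_rayEnd hX).aemeasurable,
      ?_⟩, ?_, rfl⟩
    · rw [← l2_sq, ← l2_raySpeed_map_coneRay hX x, hcone, hspeed, one_pow]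
    · refine Subtype.ext (funext fun t => Subtype.ext ?_)
      change ((m.map rayEnd).map (coneRay hX x)).map (rayEval t) = _
      rw [hcone, hR]
  refine ⟨⟨(Equiv.ofBijective G ⟨fun ν ν' h => ?_, fun R => ?_⟩).symm, fun R m hm hR => ?_⟩,
    fun g hg => ?_⟩
  · have := hprob ν
    have := hprob ν'
    have h' : ν.1.map (coneRay hX x) = ν'.1.map (coneRay hX x) :=
      eq_of_map_rayEval_eq hX (hzero ν) (hzero ν') fun t =>
        congrArg (fun R => (R.1 t).1) h
    refine Subtype.ext ?_
    rw [← map_coneRay_map_rayEnd hX x ν.1, h', map_coneRay_map_rayEnd]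
  · have hR := isWRay_of_Wdist R.2.2
    obtain ⟨m, hm, hm0, C, hC, hmC⟩ := exists_displacement_bounded hX x hR hfin
    have hmW := isWRay_map_rayEval hm0 hs (l2_raySpeed_eq_one hX hR hfin hm0 hC hmC)
    have hmR := hmW.eq_of_bounded hX hR (map_rayEval_zero hm0) R.2.1 hC hmC
    obtain ⟨ν, hν, _⟩ := hG R m hm (congrFun hmR)
    exact ⟨ν, hν⟩
  · obtain ⟨ν, hν, hνm⟩ := hG R m hm hR
    rw [← hνm, ← hν]
    exact congrArg Subtype.val (Equiv.ofBijective_symm_apply_apply G _ ν)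
  · have hgW := isWRay_of_Wdist hg
    obtain ⟨m, hm, hm0, C, hC, hmC⟩ := exists_displacement_bounded hX x hgW hfin
    have hmW := isWRay_map_rayEval hm0 hs (l2_raySpeed_eq_one hX hgW hfin hm0 hC hmC)
    refine ⟨hmW.toW2 (map_rayEval_zero hm0), ⟨C.toReal, fun t => ?_⟩, fun f ⟨C', hfC⟩ => ?_⟩
    · rw [Wdist_eq_toReal]
      exact ENNReal.toReal_mono hC (hmC t)
    · have := hgW.prob
      have hfW := isWRay_of_Wdist f.2.2
      have hprobf := hfW.prob
      refine Subtype.ext (funext fun t => Subtype.ext ?_)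
      refine congrFun (hfW.eq_of_bounded hX hmW f.2.1 (map_rayEval_zero hm0)
        (C := ENNReal.ofReal C' + C) (by finiteness) fun t => ?_) t
      refine (wEDist_triangle _ (g t).1 _).trans (add_le_add ?_ ?_)
      · rw [← ofReal_Wdist]
        exact ENNReal.ofReal_le_ofReal (hfC t)
      · rw [wEDist_comm]
        exact hmC t

end
end
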